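/- arXiv:2408.02411 — 2 statements merged into one kernel-verified Lean document; each statement's English description precedes it below -/
import Mathlib

section
/- Let v,w ∈ Δ⁺ be positive roots and let v',w' ∈ ℝ^I satisfy 0 ≤ v'_i ≤ v_i and 0 ≤ w'_i ≤ w_i for all i ∈ I. Then −Σ_{i∈I}(v'_i w_i + v_i w'_i − v'_i w'_i) + Σ_{arrows j→i of Q} v'_i w'_j ≤ max(0, −⟨w,v⟩), where the second sum runs over all arrows of Q and, for an arrow from j to i, contributes the product of v' at the target i and w' at the source j. -/
noncomputable section

namespace ADEShuffle

/-- The Euler form of a quiver with vertex set `I`, arrow set `A`,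
source map `s` and target map `t`. -/
def eulerForm {I A : Type} [Fintype I] [Fintype A] (s t : A → I) (v w : I → ℤ) : ℤ :=
  (∑ i, v i * w i) - ∑ a, v (s a) * w (t a)

/-- The real-coefficients Euler form. -/
def eulerFormR {I A : Type} [Fintype I] [Fintype A] (s t : A → I) (v w : I → ℝ) : ℝ :=
  (∑ i, v i * w i) - ∑ a, v (s a) * w (t a)

/-- The Euler form evaluated on dimension vectors in `ℕ^I`. -/
def eulerN {I A : Type} [Fintype I] [Fintype A] (s t : A → I) (v w : I → ℕ) : ℤ :=
  eulerForm s t (fun i => (v i : ℤ)) (fun i => (w i : ℤ))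

/-- Positive roots: nonzero `v ∈ ℕ^I` with `(v,v) = 2`, where `(v,w) = ⟨v,w⟩ + ⟨w,v⟩`
is the symmetrized Euler form. -/
def IsPosRoot {I A : Type} [Fintype I] [Fintype A] (s t : A → I) (v : I → ℕ) : Prop :=
  v ≠ 0 ∧ eulerN s t v v + eulerN s t v v = 2

section Helpers

set_option linter.unusedSectionVars false

open scoped Classical

variable {I A : Type} [Fintype I] [Fintype A]

lemma eF_add_left (s t : A → I) (x y z : I → ℤ) :
    eulerForm s t (x + y) z = eulerForm s t x z + eulerForm s t y z := by
  simp only [eulerForm, Pi.add_apply, add_mul, Finset.sum_add_distrib]; ring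

lemma eF_add_right (s t : A → I) (x y z : I → ℤ) :
    eulerForm s t x (y + z) = eulerForm s t x y + eulerForm s t x z := by
  simp only [eulerForm, Pi.add_apply, mul_add, Finset.sum_add_distrib]; ring

lemma eF_zero_left (s t : A → I) (z : I → ℤ) : eulerForm s t 0 z = 0 := by
  simp [eulerForm]

lemma eF_zero_right (s t : A → I) (z : I → ℤ) : eulerForm s t z 0 = 0 := by
  simp [eulerForm]

lemma eF_neg_left (s t : A → I) (x z : I → ℤ) :
    eulerForm s t (-x) z = - eulerForm s t x z := by
  have := eF_add_left s t (-x) x z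
  rw [neg_add_cancel, eF_zero_left] at this
  linarith

lemma eF_neg_right (s t : A → I) (x z : I → ℤ) :
    eulerForm s t x (-z) = - eulerForm s t x z := by
  have := eF_add_right s t x (-z) z
  rw [neg_add_cancel, eF_zero_right] at this
  linarith

lemma eF_sum_right (s t : A → I) (x : I → ℤ) (L : List (I → ℤ)) :
    eulerForm s t x L.sum = (L.map (fun y => eulerForm s t x y)).sum := by
  induction L with
  | nil => simp [eF_zero_right]
  | cons a L ih => simp [eF_add_right, ih]

lemma eF_sum_left (s t : A → I) (x : I → ℤ) (L : List (I → ℤ)) :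
    eulerForm s t L.sum x = (L.map (fun y => eulerForm s t y x)).sum := by
  induction L with
  | nil => simp [eF_zero_left]
  | cons a L ih => simp [eF_add_left, ih]

/-- Integral positive definiteness. -/
def PD (s t : A → I) : Prop := ∀ x : I → ℤ, x ≠ 0 → 0 < eulerForm s t x x

/-- Roots that are nonnegative. -/
def PR (s t : A → I) (x : I → ℤ) : Prop := 0 ≤ x ∧ eulerForm s t x x = 1

/-- Simple root. -/
def sm (k : I) : I → ℤ := Pi.single k 1

lemma sm_nonneg (k : I) : 0 ≤ sm k := by
  intro i; by_cases h : i = k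
  · subst h; simp [sm]
  · simp [sm, h]

lemma sm_ne (k : I) : sm k ≠ 0 := by
  intro h; have := congrFun h k; simp [sm] at this

lemma pr_ne {s t : A → I} {x : I → ℤ} (h : eulerForm s t x x = 1) : x ≠ 0 := by
  rintro rfl; rw [eF_zero_left] at h; omega

lemma count {s t : A → I} (h : PD s t) (X : Finset I) (hX : X.Nonempty) :
    (Finset.univ.filter (fun a => s a ∈ X ∧ t a ∈ X)).card < X.card := by
  have h1 := h (fun i => if i ∈ X then 1 else 0) (by
    obtain ⟨i, hi⟩ := hX
    intro h0; have := congrFun h0 i; simp [hi] at this)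
  have e : eulerForm s t (fun i => if i ∈ X then 1 else 0) (fun i => if i ∈ X then 1 else 0)
      = (X.card : ℤ) - (Finset.univ.filter (fun a => s a ∈ X ∧ t a ∈ X)).card := by
    unfold eulerForm
    congr 1
    · simp
    · simp [ite_and, Finset.card_filter]
      refine Finset.sum_congr rfl fun a _ => ?_
      by_cases h1 : s a ∈ X <;> by_cases h2 : t a ∈ X <;> simp [h1, h2]
  rw [e] at h1
  omega

lemma noloop {s t : A → I} (h : PD s t) (a : A) : s a ≠ t a := by
  intro ha
  have := count h {s a} (by simp)
  simp only [Finset.card_singleton, Nat.lt_one_iff, Finset.card_eq_zero] at this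
  have h2 : a ∈ (Finset.univ.filter (fun b => s b ∈ ({s a} : Finset I) ∧ t b ∈ ({s a} : Finset I))) := by
    simp [← ha]
  rw [this] at h2
  simp at h2

lemma eF_sm_sm {s t : A → I} (h : PD s t) (k : I) : eulerForm s t (sm k) (sm k) = 1 := by
  unfold eulerForm
  have : ∀ a, sm k (s a) * sm k (t a) = 0 := by
    intro a
    have := noloop h a
    by_cases h1 : s a = k
    · have : t a ≠ k := by rintro rfl; exact this h1
      simp [sm, this]
    · simp [sm, h1]
  simp [this]
  simp [sm, Pi.single_apply]

/-- pairing of distinct simple roots along an arrow -/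
lemma eF_sm_arrow {s t : A → I} (h : PD s t) (a : A) :
    eulerForm s t (sm (s a)) (sm (t a)) ≤ -1 := by
  unfold eulerForm
  have h0 := noloop h a
  have h1 : ∑ i, sm (s a) i * sm (t a) i = 0 := by
    apply Finset.sum_eq_zero
    intro i _
    by_cases h2 : i = s a
    · subst h2; simp [sm, h0]
    · simp [sm, h2]
  have h2 : (1 : ℤ) ≤ ∑ b, sm (s a) (s b) * sm (t a) (t b) := by
    have := Finset.single_le_sum (f := fun b => sm (s a) (s b) * sm (t a) (t b))
      (fun b _ => mul_nonneg (sm_nonneg _ _) (sm_nonneg _ _)) (Finset.mem_univ a)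
    simpa [sm] using this
  omega

lemma root_sign {s t : A → I} (h : PD s t) {x : I → ℤ} (hx : eulerForm s t x x = 1) :
    0 ≤ x ∨ x ≤ 0 := by
  set p : I → ℤ := fun i => max (x i) 0 with hp
  set n : I → ℤ := fun i => max (-x i) 0 with hn
  have e : x = p + -n := by
    ext i; simp only [hp, hn, Pi.add_apply, Pi.neg_apply]; omega
  have hp0 : ∀ i, 0 ≤ p i := fun i => le_max_right _ _
  have hn0 : ∀ i, 0 ≤ n i := fun i => le_max_right _ _
  have hpn : ∀ i, p i * n i = 0 := by
    intro i
    simp only [hp, hn]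
    rcases le_total (x i) 0 with h | h
    · rw [max_eq_right h]; simp
    · rw [max_eq_right (a := -x i) (by omega)]; simp
  have h1 : eulerForm s t p n ≤ 0 := by
    unfold eulerForm
    simp only [hpn, Finset.sum_const_zero, zero_sub, Left.neg_nonpos_iff]
    exact Finset.sum_nonneg fun a _ => mul_nonneg (hp0 _) (hn0 _)
  have h2 : eulerForm s t n p ≤ 0 := by
    unfold eulerForm
    simp only [mul_comm (n _) (p _), hpn, Finset.sum_const_zero, zero_sub, Left.neg_nonpos_iff]
    exact Finset.sum_nonneg fun a _ => mul_nonneg (hp0 _) (hn0 _)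
  rw [e] at hx
  simp only [eF_add_left, eF_add_right, eF_neg_left, eF_neg_right] at hx
  by_cases hp1 : p = 0
  · right; rw [e, hp1]; intro i; simp [hn0]
  by_cases hn1 : n = 0
  · left; rw [e, hn1]; intro i; simp [hp0]
  have := h p hp1
  have := h n hn1
  omega

/-- The set of positive roots is finite (reduce mod 2). -/
lemma finite_roots {s t : A → I} (h : PD s t) : {x | PR s t x}.Finite := by
  apply Set.Finite.of_injOn (f := fun (x : I → ℤ) (i : I) => (x i : ZMod 2)) (t := Set.univ)
    (fun _ _ => Set.mem_univ _) _ (Set.toFinite _)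
  intro x hx y hy hxy
  have hd : ∀ i, ∃ d, x i = y i + 2 * d := by
    intro i
    have := congrFun hxy i
    simp only at this
    have h2 := (ZMod.intCast_eq_intCast_iff_dvd_sub _ _ _).1 this.symm
    obtain ⟨d, hd⟩ := h2
    exact ⟨d, by push_cast at hd; omega⟩
  choose d hd using hd
  have e : x = y + (d + d) := by ext i; simp [hd i]; ring
  have hx1 := hx.2
  have hy1 := hy.2
  -- (x-y)/2 = d, (x+y)/2 = y + d
  have e1 : eulerForm s t (y + d) (y + d) + eulerForm s t d d = 1 := by
    rw [e] at hx1
    simp only [eF_add_left, eF_add_right] at hx1 ⊢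
    linarith
  by_cases h0 : d = 0
  · rw [e, h0]; simp
  by_cases h1 : y + d = 0
  · exfalso
    have : x = -y := by
      have : d = -y := by rw [eq_neg_iff_add_eq_zero, add_comm]; exact h1
      rw [e, this]; abel
    have hx0 := hx.1
    rw [this] at hx0
    have : y = 0 := le_antisymm (by simpa using hx0) hy.1
    exact pr_ne hy1 this
  have := h _ h0
  have := h _ h1
  omega

/-! Reflections -/

def rs (s t : A → I) (k : I) : A → I := fun a => if t a = k then t a else s a
def rt (s t : A → I) (k : I) : A → I := fun a => if t a = k then s a else t a

/-- sum over incoming arrows -/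
def inc (s t : A → I) (k : I) (x : I → ℤ) : ℤ := ∑ a, if t a = k then x (s a) else 0

def Sink (s : A → I) (k : I) : Prop := ∀ a, s a ≠ k

def rfl0 (s t : A → I) (k : I) (x : I → ℤ) : I → ℤ := Function.update x k (inc s t k x - x k)

lemma inc_congr {s t : A → I} {k : I} (hk : Sink s k) {x y : I → ℤ} (h : ∀ i, i ≠ k → x i = y i) :
    inc s t k x = inc s t k y := by
  unfold inc
  refine Finset.sum_congr rfl fun a _ => ?_
  rw [h _ (hk a)]

lemma inc_nonneg (s t : A → I) (k : I) {x : I → ℤ} (hx : 0 ≤ x) : 0 ≤ inc s t k x := by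
  unfold inc
  refine Finset.sum_nonneg fun a _ => ?_
  split_ifs
  · exact hx _
  · rfl

lemma rfl0_ne (s t : A → I) (k : I) (x : I → ℤ) {i : I} (h : i ≠ k) : rfl0 s t k x i = x i := by
  simp [rfl0, h]

lemma rfl0_k (s t : A → I) (k : I) (x : I → ℤ) : rfl0 s t k x k = inc s t k x - x k := by
  simp [rfl0]

lemma rfl0_invol {s t : A → I} {k : I} (hk : Sink s k) (x : I → ℤ) :
    rfl0 s t k (rfl0 s t k x) = x := by
  ext i
  by_cases h : i = k
  · subst h
    rw [rfl0_k, rfl0_k, inc_congr hk (fun j hj => rfl0_ne s t _ x hj)]; ring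
  · rw [rfl0_ne _ _ _ _ h, rfl0_ne _ _ _ _ h]

lemma rfl0_add (s t : A → I) (k : I) (x y : I → ℤ) :
    rfl0 s t k (x + y) = rfl0 s t k x + rfl0 s t k y := by
  ext i
  by_cases h : i = k
  · subst h
    simp only [rfl0_k, Pi.add_apply, inc]
    have : ∀ a, (if t a = i then x (s a) + y (s a) else 0)
        = (if t a = i then x (s a) else 0) + (if t a = i then y (s a) else 0) := by
      intro a; split_ifs <;> simp
    simp only [this, Finset.sum_add_distrib]; ring
  · simp [rfl0_ne _ _ _ _ h]

def reflE {s : A → I} (t : A → I) {k : I} (hk : Sink s k) : (I → ℤ) ≃+ (I → ℤ) where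
  toFun := rfl0 s t k
  invFun := rfl0 s t k
  left_inv := rfl0_invol hk
  right_inv := rfl0_invol hk
  map_add' := rfl0_add s t k

lemma reflE_apply {s : A → I} (t : A → I) {k : I} (hk : Sink s k) (x : I → ℤ) :
    reflE t hk x = rfl0 s t k x := rfl

lemma reflE_symm {s : A → I} (t : A → I) {k : I} (hk : Sink s k) (x : I → ℤ) :
    (reflE t hk).symm x = rfl0 s t k x := rfl

lemma eF_rfl {s t : A → I} {k : I} (hk : Sink s k) (x y : I → ℤ) :
    eulerForm (rs s t k) (rt s t k) (rfl0 s t k x) (rfl0 s t k y) = eulerForm s t x y := by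
  unfold eulerForm
  have e1 : ∀ u v : I → ℤ, ∑ i, u i * v i = u k * v k + ∑ i ∈ Finset.univ.erase k, u i * v i := by
    intro u v; exact (Finset.add_sum_erase _ (fun i => u i * v i) (Finset.mem_univ k)).symm
  have e2 : ∀ f : A → ℤ, ∑ a, f a = (∑ a, if t a = k then f a else 0)
      + ∑ a, if t a = k then 0 else f a := by
    intro f; rw [← Finset.sum_add_distrib]
    refine Finset.sum_congr rfl fun a _ => ?_
    split_ifs <;> simp
  rw [e1, e1 x y, e2, e2 (fun a => x (s a) * y (t a))]
  have h1 : ∑ i ∈ Finset.univ.erase k, rfl0 s t k x i * rfl0 s t k y i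
      = ∑ i ∈ Finset.univ.erase k, x i * y i := by
    refine Finset.sum_congr rfl fun i hi => ?_
    have := Finset.ne_of_mem_erase hi
    rw [rfl0_ne _ _ _ _ this, rfl0_ne _ _ _ _ this]
  have h2 : (∑ a, if t a = k then (0:ℤ) else rfl0 s t k x (rs s t k a) * rfl0 s t k y (rt s t k a))
      = ∑ a, if t a = k then 0 else x (s a) * y (t a) := by
    refine Finset.sum_congr rfl fun a _ => ?_
    split_ifs with h
    · rfl
    · simp only [rs, rt, h, if_false]
      rw [rfl0_ne _ _ _ _ (hk a), rfl0_ne _ _ _ _ h]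
  have h3 : (∑ a, if t a = k then rfl0 s t k x (rs s t k a) * rfl0 s t k y (rt s t k a) else 0)
      = (inc s t k x - x k) * inc s t k y := by
    unfold inc
    rw [Finset.mul_sum]
    refine Finset.sum_congr rfl fun a _ => ?_
    split_ifs with h
    · simp only [rs, rt, h, if_true]
      rw [rfl0_k, rfl0_ne _ _ _ _ (hk a)]; rfl
    · simp
  have h4 : (∑ a, if t a = k then x (s a) * y (t a) else 0) = inc s t k x * y k := by
    unfold inc
    rw [Finset.sum_mul]
    refine Finset.sum_congr rfl fun a _ => ?_
    split_ifs with h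
    · rw [h]
    · simp
  rw [h1, h2, h3, h4, rfl0_k, rfl0_k]
  ring

lemma eF_sm_left {s : A → I} (t : A → I) {k : I} (hk : Sink s k) (x : I → ℤ) :
    eulerForm s t (sm k) x = x k := by
  unfold eulerForm
  have : ∀ a, sm k (s a) = 0 := fun a => by simp [sm, hk a]
  simp [this]
  simp [sm, Pi.single_apply]

lemma eF_sm_right (s t : A → I) (k : I) (x : I → ℤ) :
    eulerForm s t x (sm k) = x k - inc s t k x := by
  unfold eulerForm inc
  congr 1
  · simp [sm, Pi.single_apply]
  · simp [sm, Pi.single_apply]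

lemma rfl0_sm {s : A → I} (t : A → I) {k : I} (hk : Sink s k) : rfl0 s t k (sm k) = - sm k := by
  ext i
  by_cases h : i = k
  · subst h
    rw [rfl0_k]
    have : inc s t i (sm i) = 0 := by
      unfold inc; apply Finset.sum_eq_zero; intro a _; simp [sm, hk a]
    rw [this]; simp
  · rw [rfl0_ne _ _ _ _ h]; simp [sm, h]

/-- in the reflected quiver, pairing with the simple root at the new source -/
lemma eF_rfl_sm {s t : A → I} {k : I} (hk : Sink s k) (x : I → ℤ) :
    eulerForm (rs s t k) (rt s t k) (rfl0 s t k x) (sm k) = (rfl0 s t k x) k := by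
  have : sm k = rfl0 s t k (- sm k) := by
    have := rfl0_invol (t := t) hk (sm k)
    rw [rfl0_sm t hk] at this; exact this.symm
  rw [this, eF_rfl hk, eF_neg_right, eF_sm_right, rfl0_k]; ring

lemma PD_rfl {s t : A → I} {k : I} (hk : Sink s k) (h : PD s t) :
    PD (rs s t k) (rt s t k) := by
  intro x hx
  rw [← rfl0_invol (t := t) hk x, eF_rfl hk]
  apply h
  intro h0
  apply hx
  rw [← rfl0_invol (t := t) hk x, h0]
  exact (reflE t hk).map_zero

/-- a positive root other than the simple one stays positive -/
lemma rfl0_pos {s t : A → I} {k : I} (hk : Sink s k) (h : PD s t) {x : I → ℤ}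
    (hx : 0 ≤ x) (hx1 : eulerForm s t x x = 1) (hne : x ≠ sm k) : 0 ≤ rfl0 s t k x := by
  have h1 : eulerForm (rs s t k) (rt s t k) (rfl0 s t k x) (rfl0 s t k x) = 1 := by
    rw [eF_rfl hk, hx1]
  rcases root_sign (PD_rfl hk h) h1 with h2 | h2
  · exact h2
  exfalso
  have h3 : ∀ i, i ≠ k → x i = 0 := by
    intro i hi
    have := h2 i
    rw [rfl0_ne _ _ _ _ hi] at this
    exact le_antisymm this (hx i)
  have h4 : eulerForm s t x x = x k * x k := by
    unfold eulerForm
    rw [Finset.sum_eq_single k, Finset.sum_eq_zero, sub_zero]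
    · intro a _; rw [h3 _ (hk a)]; simp
    · intro i _ hi; rw [h3 i hi]; simp
    · simp
  have h5 : x k = 1 := by
    have := hx k
    simp only [Pi.zero_apply] at this
    nlinarith
  apply hne
  ext i
  by_cases hi : i = k
  · subst hi; simp [h5, sm]
  · simp [h3 i hi, sm, hi]

/-! States: quivers reached from the base quiver by sink reflections -/

structure St (s t s' t' : A → I) (σ : (I → ℤ) ≃+ (I → ℤ)) : Prop where
  iso : ∀ x y, eulerForm s' t' (σ x) (σ y) = eulerForm s t x y
  inv : ∀ x z, PR s t x → 0 ≤ σ x → PR s t z → σ z ≤ 0 → eulerForm s t x z ≤ 0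

lemma St.isoS {s t s' t' : A → I} {σ : (I → ℤ) ≃+ (I → ℤ)} (h : St s t s' t' σ) (x y : I → ℤ) :
    eulerForm s t (σ.symm x) (σ.symm y) = eulerForm s' t' x y := by
  rw [← h.iso]; simp

lemma St.pd {s t s' t' : A → I} {σ : (I → ℤ) ≃+ (I → ℤ)} (h : St s t s' t' σ) (hq : PD s t) :
    PD s' t' := by
  intro x hx
  rw [← h.isoS]
  apply hq
  intro h0
  apply hx
  simpa using h0

/-- remaining roots -/
def Rem (s t : A → I) (σ : (I → ℤ) ≃+ (I → ℤ)) : Set (I → ℤ) := {x | PR s t x ∧ 0 ≤ σ x}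

lemma St.init (s t : A → I) : St s t s t (AddEquiv.refl _) where
  iso := fun _ _ => rfl
  inv := by
    intro x z _ _ hz hz'
    exfalso
    exact pr_ne hz.2 (le_antisymm hz' hz.1)

lemma decomp (x : I → ℤ) : x = ∑ i, x i • sm i := by
  ext j
  simp [sm, Finset.sum_apply, Pi.single_apply]

lemma St.terminal {s t s' t' : A → I} {σ : (I → ℤ) ≃+ (I → ℤ)} (h : St s t s' t' σ) (hq : PD s t)
    (hP : ∀ i, ¬ 0 ≤ σ.symm (sm i)) (x : I → ℤ) (hx : 0 ≤ x) (hsx : 0 ≤ σ x) : x = 0 := by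
  apply le_antisymm _ hx
  have h1 : ∀ i, σ.symm (sm i) ≤ 0 := by
    intro i
    rcases root_sign hq (x := σ.symm (sm i)) (by rw [h.isoS, eF_sm_sm (h.pd hq)]) with h2 | h2
    · exact absurd h2 (hP i)
    · exact h2
  have h2 : x = ∑ i, (σ x) i • σ.symm (sm i) := by
    have := congrArg σ.symm (decomp (σ x))
    rw [map_sum, σ.symm_apply_apply] at this
    simp only [map_zsmul] at this
    exact this
  rw [h2]
  apply Finset.sum_nonpos
  intro i _ j
  have := h1 i j
  have := hsx i
  simp only [Pi.zero_apply, Pi.smul_apply, smul_eq_mul] at *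
  nlinarith

lemma St.sink {s t s' t' : A → I} {σ : (I → ℤ) ≃+ (I → ℤ)} (h : St s t s' t' σ) (hq : PD s t)
    (hP : ∃ i, 0 ≤ σ.symm (sm i)) : ∃ k, Sink s' k ∧ 0 ≤ σ.symm (sm k) := by
  by_contra! hcon
  have hq' := h.pd hq
  set P : Finset I := Finset.univ.filter (fun i => 0 ≤ σ.symm (sm i)) with hPdef
  have hPn : P.Nonempty := by
    obtain ⟨i, hi⟩ := hP
    exact ⟨i, by simp [hPdef, hi]⟩
  have hclosed : ∀ a, s' a ∈ P → t' a ∈ P := by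
    intro a ha
    simp only [hPdef, Finset.mem_filter, Finset.mem_univ, true_and] at ha ⊢
    by_contra hj
    have hr : ∀ i, eulerForm s t (σ.symm (sm i)) (σ.symm (sm i)) = 1 := by
      intro i; rw [h.isoS, eF_sm_sm hq']
    have hneg : σ.symm (sm (t' a)) ≤ 0 := (root_sign hq (hr _)).resolve_left hj
    have := h.inv (σ.symm (sm (s' a))) (-σ.symm (sm (t' a))) ⟨ha, hr _⟩
      (by simpa using sm_nonneg _)
      ⟨by simpa using hneg, by rw [eF_neg_left, eF_neg_right, hr]; rfl⟩
      (by rw [map_neg]; simpa using sm_nonneg _)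
    rw [eF_neg_right, h.isoS] at this
    have := eF_sm_arrow hq' a
    omega
  have hout : ∀ i ∈ P, ∃ a, s' a = i := by
    intro i hi
    by_contra! hc
    have : 0 ≤ σ.symm (sm i) := by simpa [hPdef] using hi
    exact hcon i hc this
  have hc := count hq' P hPn
  have : P.card ≤ (Finset.univ.filter (fun a => s' a ∈ P ∧ t' a ∈ P)).card := by
    apply Finset.card_le_card_of_surjOn s'
    intro i hi
    obtain ⟨a, ha⟩ := hout i hi
    have hs : s' a ∈ P := by rw [ha]; exact hi
    exact ⟨a, by simpa using ⟨hs, hclosed a hs⟩, ha⟩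
  omega

/-- relation of the simple root at the sink with the other remaining roots -/
lemma St.order {s t s' t' : A → I} {σ : (I → ℤ) ≃+ (I → ℤ)} (h : St s t s' t' σ) (hq : PD s t)
    {k : I} (hk : Sink s' k) {x : I → ℤ} (hx : x ∈ Rem s t σ) (hne : x ≠ σ.symm (sm k)) :
    0 ≤ rfl0 s' t' k (σ x) ∧ 0 ≤ eulerForm s t (σ.symm (sm k)) x
      ∧ eulerForm s t x (σ.symm (sm k)) ≤ 0 := by
  have h1 : 0 ≤ rfl0 s' t' k (σ x) := by
    apply rfl0_pos hk (h.pd hq) hx.2 (by rw [h.iso]; exact hx.1.2)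
    intro h0
    apply hne
    rw [← h0]; simp
  refine ⟨h1, ?_, ?_⟩
  · rw [← h.iso, σ.apply_symm_apply, eF_sm_left t' hk]
    exact hx.2 k
  · rw [← h.iso, σ.apply_symm_apply, eF_sm_right]
    have := h1 k
    rw [rfl0_k] at this
    simp only [Pi.zero_apply] at this
    omega

lemma St.next {s t s' t' : A → I} {σ : (I → ℤ) ≃+ (I → ℤ)} (h : St s t s' t' σ) (hq : PD s t)
    {k : I} (hk : Sink s' k) (hkP : 0 ≤ σ.symm (sm k)) :
    St s t (rs s' t' k) (rt s' t' k) (σ.trans (reflE t' hk)) where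
  iso := by
    intro x y
    simp only [AddEquiv.trans_apply, reflE_apply]
    rw [eF_rfl hk, h.iso]
  inv := by
    intro x z hx hsx hz hsz
    simp only [AddEquiv.trans_apply, reflE_apply] at hsx hsz
    -- x was remaining before (or x = - simple root)
    have hzr : eulerForm s' t' (σ z) (σ z) = 1 := by rw [h.iso]; exact hz.2
    have hxr : eulerForm s' t' (σ x) (σ x) = 1 := by rw [h.iso]; exact hx.2
    have hq' := h.pd hq
    -- sign of σ z
    have hzc : σ z ≤ 0 ∨ σ z = sm k := by
      rcases root_sign hq' hzr with h1 | h1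
      · right
        by_contra hne
        have h2 := rfl0_pos hk hq' h1 hzr hne
        have h3 : rfl0 s' t' k (σ z) = 0 := le_antisymm hsz h2
        have h4 : eulerForm (rs s' t' k) (rt s' t' k) (rfl0 s' t' k (σ z)) (rfl0 s' t' k (σ z)) = 1 := by
          rw [eF_rfl hk, hzr]
        exact pr_ne h4 h3
      · left; exact h1
    have hxc : 0 ≤ σ x ∨ σ x = - sm k := by
      rcases root_sign hq' hxr with h1 | h1
      · left; exact h1
      · right
        by_contra hne
        have h2 := rfl0_pos hk hq' (x := - σ x) (by simpa using h1)
          (by rw [eF_neg_left, eF_neg_right, hxr]; rfl) (by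
            intro h0; apply hne; rw [← h0]; simp)
        have e : rfl0 s' t' k (- σ x) = - rfl0 s' t' k (σ x) := (reflE t' hk).map_neg _
        rw [e] at h2
        have h3 : rfl0 s' t' k (σ x) = 0 := le_antisymm (by simpa using h2) hsx
        have h4 : eulerForm (rs s' t' k) (rt s' t' k) (rfl0 s' t' k (σ x)) (rfl0 s' t' k (σ x)) = 1 := by
          rw [eF_rfl hk, hxr]
        exact pr_ne h4 h3
    rcases hxc with hxc | hxc
    · rcases hzc with hzc | hzc
      · exact h.inv x z hx hxc hz hzc
      · have e : z = σ.symm (sm k) := by rw [← hzc]; simp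
        rw [← h.iso, hzc, eF_sm_right]
        have := hsx k
        rw [rfl0_k] at this
        simp only [Pi.zero_apply] at this
        omega
    · exfalso
      have e : x = - σ.symm (sm k) := by rw [← map_neg, ← hxc]; simp
      apply pr_ne hx.2
      apply le_antisymm _ hx.1
      rw [e]; simpa using hkP

lemma Rem_next {s t s' t' : A → I} {σ : (I → ℤ) ≃+ (I → ℤ)} (h : St s t s' t' σ) (hq : PD s t)
    {k : I} (hk : Sink s' k) (hkP : 0 ≤ σ.symm (sm k)) :
    (Rem s t (σ.trans (reflE t' hk))) ⊆ Rem s t σ ∧ σ.symm (sm k) ∈ Rem s t σ ∧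
      σ.symm (sm k) ∉ Rem s t (σ.trans (reflE t' hk)) := by
  have hq' := h.pd hq
  refine ⟨?_, ⟨⟨hkP, by rw [h.isoS, eF_sm_sm hq']⟩, by simpa using sm_nonneg k⟩, ?_⟩
  · intro x hx
    refine ⟨hx.1, ?_⟩
    have hxr : eulerForm s' t' (σ x) (σ x) = 1 := by rw [h.iso]; exact hx.1.2
    have hsx : 0 ≤ rfl0 s' t' k (σ x) := hx.2
    rcases root_sign hq' hxr with h1 | h1
    · exact h1
    · exfalso
      by_cases hne : σ x = - sm k
      · have e : x = - σ.symm (sm k) := by rw [← map_neg, ← hne]; simp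
        apply pr_ne hx.1.2
        apply le_antisymm _ hx.1.1
        rw [e]; simpa using hkP
      · have h2 := rfl0_pos hk hq' (x := - σ x) (by simpa using h1)
          (by rw [eF_neg_left, eF_neg_right, hxr]; rfl) (by
            intro h0; apply hne; rw [← h0]; simp)
        have e : rfl0 s' t' k (- σ x) = - rfl0 s' t' k (σ x) := (reflE t' hk).map_neg _
        rw [e] at h2
        have h3 : rfl0 s' t' k (σ x) = 0 := le_antisymm (by simpa using h2) hsx
        have h4 : eulerForm (rs s' t' k) (rt s' t' k) (rfl0 s' t' k (σ x)) (rfl0 s' t' k (σ x)) = 1 := by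
          rw [eF_rfl hk, hxr]
        exact pr_ne h4 h3
  · intro h0
    have := h0.2 k
    simp only [AddEquiv.trans_apply, reflE_apply, σ.apply_symm_apply] at this
    rw [rfl0_sm t' hk] at this
    simp [sm] at this

/-- induction over states -/
lemma St.induction {s t : A → I} (hq : PD s t)
    (M : (A → I) → (A → I) → ((I → ℤ) ≃+ (I → ℤ)) → Prop)
    (h0 : ∀ s' t' σ, St s t s' t' σ → (∀ i, ¬ 0 ≤ σ.symm (sm i)) → M s' t' σ)
    (h1 : ∀ s' t' σ, St s t s' t' σ → ∀ k, ∀ hk : Sink s' k, 0 ≤ σ.symm (sm k) →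
      M (rs s' t' k) (rt s' t' k) (σ.trans (reflE t' hk)) → M s' t' σ) :
    M s t (AddEquiv.refl _) := by
  have hfin : ∀ σ, (Rem s t σ).Finite := fun σ => (finite_roots hq).subset fun x hx => hx.1
  have main : ∀ n s' t' σ, St s t s' t' σ → (Rem s t σ).ncard = n → M s' t' σ := by
    intro n
    induction n using Nat.strong_induction_on with
    | _ n ih =>
      intro s' t' σ h hn
      by_cases hP : ∃ i, 0 ≤ σ.symm (sm i)
      · obtain ⟨k, hk, hkP⟩ := h.sink hq hP
        apply h1 s' t' σ h k hk hkP
        obtain ⟨r1, r2, r3⟩ := Rem_next h hq hk hkP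
        refine ih _ ?_ _ _ _ (h.next hq hk hkP) rfl
        rw [← hn]
        exact Set.ncard_lt_ncard ⟨r1, fun hc => r3 (hc r2)⟩ (hfin _)
      · push Not at hP
        exact h0 s' t' σ h hP
  exact main _ _ _ _ (St.init s t) rfl

/-- the order on positive roots -/
lemma exists_order {s t : A → I} (hq : PD s t) :
    ∃ n : (I → ℤ) → ℕ, ∀ x y, PR s t x → PR s t y →
      (n x = n y → x = y) ∧ (n x < n y → 0 ≤ eulerForm s t x y ∧ eulerForm s t y x ≤ 0) := by
  have := St.induction hq (fun s' t' σ => ∃ n : (I → ℤ) → ℕ, ∀ x y, x ∈ Rem s t σ → y ∈ Rem s t σ →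
      (n x = n y → x = y) ∧ (n x < n y → 0 ≤ eulerForm s t x y ∧ eulerForm s t y x ≤ 0)) ?_ ?_
  · obtain ⟨n, hn⟩ := this
    exact ⟨n, fun x y hx hy => hn x y ⟨hx, hx.1⟩ ⟨hy, hy.1⟩⟩
  · intro s' t' σ h hP
    refine ⟨fun _ => 0, fun x y hx hy => ?_⟩
    exact absurd (h.terminal hq hP x hx.1.1 hx.2) (pr_ne hx.1.2)
  · rintro s' t' σ h k hk hkP ⟨n, hn⟩
    refine ⟨fun x => if x = σ.symm (sm k) then 0 else n x + 1, fun x y hx hy => ?_⟩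
    beta_reduce
    by_cases h1 : x = σ.symm (sm k)
    · by_cases h2 : y = σ.symm (sm k)
      · subst h1; subst h2; simp
      · have := h.order hq hk hy h2
        rw [if_pos h1, if_neg h2]
        subst h1
        exact ⟨by omega, fun _ => ⟨this.2.1, this.2.2⟩⟩
    · by_cases h2 : y = σ.symm (sm k)
      · rw [if_pos h2, if_neg h1]
        exact ⟨by omega, by omega⟩
      · rw [if_neg h2, if_neg h1]
        have := hn x y ⟨hx.1, (h.order hq hk hx h1).1⟩ ⟨hy.1, (h.order hq hk hy h2).1⟩
        simpa using this

/-- generic decompositions -/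
def Gen (s t : A → I) (y : I → ℤ) : Prop :=
  ∃ L : List (I → ℤ), L.sum = y ∧ (∀ x ∈ L, PR s t x) ∧ ∀ x ∈ L, ∀ z ∈ L, 0 ≤ eulerForm s t x z

lemma sum_map_rfl0 {s t : A → I} {k : I} (hk : Sink s k) (L : List (I → ℤ)) :
    (L.map (rfl0 s t k)).sum = rfl0 s t k L.sum :=
  (map_list_sum (reflE t hk) L).symm

lemma mem_nonneg_le_sum {L : List (I → ℤ)} (hL : ∀ x ∈ L, 0 ≤ x) {x : I → ℤ} (hx : x ∈ L) :
    x ≤ L.sum := List.single_le_sum hL x hx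

lemma Gen.step0 {s t : A → I} (hq : PD s t) {k : I} (hk : Sink s k) {y : I → ℤ} (hy : 0 ≤ y)
    (h : Gen (rs s t k) (rt s t k) (rfl0 s t k y)) : Gen s t y := by
  obtain ⟨L, hsum, hpos, hge⟩ := h
  have hq' := PD_rfl (t := t) hk hq
  have hE : ∀ x z, eulerForm s t (rfl0 s t k x) (rfl0 s t k z) = eulerForm (rs s t k) (rt s t k) x z := by
    intro x z
    rw [← eF_rfl hk, rfl0_invol hk, rfl0_invol hk]
  have hnot : sm k ∉ L := by
    intro hmem
    have h1 : eulerForm (rs s t k) (rt s t k) (sm k) (rfl0 s t k y) = - y k := by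
      rw [← hE, rfl0_invol hk, rfl0_sm t hk, eF_neg_left, eF_sm_left t hk]
    rw [← hsum, eF_sum_right] at h1
    have h2 : eulerForm (rs s t k) (rt s t k) (sm k) (sm k) ≤
        (L.map (fun z => eulerForm (rs s t k) (rt s t k) (sm k) z)).sum := by
      apply List.single_le_sum
      · intro c hc
        obtain ⟨z, hz, rfl⟩ := List.mem_map.1 hc
        exact hge _ hmem _ hz
      · exact List.mem_map.2 ⟨_, hmem, rfl⟩
    rw [eF_sm_sm hq', h1] at h2
    have := hy k
    simp only [Pi.zero_apply] at this
    omega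
  refine ⟨L.map (rfl0 s t k), ?_, ?_, ?_⟩
  · rw [sum_map_rfl0 hk, hsum, rfl0_invol hk]
  · intro x hx
    obtain ⟨z, hz, rfl⟩ := List.mem_map.1 hx
    have h1 : eulerForm s t (rfl0 s t k z) (rfl0 s t k z) = 1 := by rw [hE]; exact (hpos z hz).2
    refine ⟨?_, h1⟩
    rcases root_sign hq h1 with h2 | h2
    · exact h2
    · exfalso
      by_cases hne : - rfl0 s t k z = sm k
      · apply hnot
        have : z = sm k := by
          have e : rfl0 s t k z = - sm k := by rw [← hne]; simp
          rw [← rfl0_sm t hk] at e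
          exact (reflE t hk).injective e
        rw [← this]; exact hz
      · have h3 := rfl0_pos hk hq (x := - rfl0 s t k z) (by simpa using h2)
          (by rw [eF_neg_left, eF_neg_right, h1]; rfl) hne
        have e : rfl0 s t k (- rfl0 s t k z) = - rfl0 s t k (rfl0 s t k z) := (reflE t hk).map_neg _
        rw [e, rfl0_invol hk] at h3
        exact pr_ne (hpos z hz).2 (le_antisymm (by simpa using h3) (hpos z hz).1)
  · intro x hx z hz
    obtain ⟨x, hx', rfl⟩ := List.mem_map.1 hx
    obtain ⟨z, hz', rfl⟩ := List.mem_map.1 hz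
    rw [hE]
    exact hge x hx' z hz'

lemma Gen.step1 {s t : A → I} (hq : PD s t) {k : I} (hk : Sink s k) {y : I → ℤ}
    (hy : rfl0 s t k y k = 0) (hy0 : 0 ≤ y) (r : ℕ)
    (h : Gen (rs s t k) (rt s t k) (rfl0 s t k y)) : Gen s t (r • sm k + y) := by
  obtain ⟨L', hsum', hpos', hge'⟩ := id h
  have hq' := PD_rfl (t := t) hk hq
  have hk0 : ∀ x ∈ L', x k = 0 := by
    intro x hx
    have := mem_nonneg_le_sum (fun x hx => (hpos' x hx).1) hx k
    rw [hsum', hy] at this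
    exact le_antisymm this ((hpos' x hx).1 k)
  have hE : ∀ x z, eulerForm s t (rfl0 s t k x) (rfl0 s t k z) = eulerForm (rs s t k) (rt s t k) x z := by
    intro x z
    rw [← eF_rfl hk, rfl0_invol hk, rfl0_invol hk]
  have hP : ∀ z ∈ L', 0 ≤ rfl0 s t k z := by
    intro z hz i
    by_cases hi : i = k
    · subst hi
      rw [rfl0_k, hk0 z hz]
      simpa using inc_nonneg s t i (hpos' z hz).1
    · rw [rfl0_ne _ _ _ _ hi]; exact (hpos' z hz).1 i
  refine ⟨List.replicate r (sm k) ++ L'.map (rfl0 s t k), ?_, ?_, ?_⟩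
  · rw [List.sum_append, List.sum_replicate, sum_map_rfl0 hk, hsum', rfl0_invol hk]
  · intro x hx
    rcases List.mem_append.1 hx with hx | hx
    · rw [List.eq_of_mem_replicate hx]
      exact ⟨sm_nonneg k, eF_sm_sm hq k⟩
    · obtain ⟨z, hz, rfl⟩ := List.mem_map.1 hx
      exact ⟨hP z hz, by rw [hE]; exact (hpos' z hz).2⟩
  · intro x hx z hz
    rcases List.mem_append.1 hx with hx | hx
    · rw [List.eq_of_mem_replicate hx, eF_sm_left t hk]
      rcases List.mem_append.1 hz with hz | hz
      · rw [List.eq_of_mem_replicate hz]; exact sm_nonneg k k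
      · obtain ⟨z, hz', rfl⟩ := List.mem_map.1 hz
        exact hP z hz' k
    · obtain ⟨x, hx', rfl⟩ := List.mem_map.1 hx
      rcases List.mem_append.1 hz with hz | hz
      · rw [List.eq_of_mem_replicate hz, eF_sm_right]
        have h1 : inc s t k (rfl0 s t k x) = inc s t k x :=
          inc_congr hk fun j hj => rfl0_ne s t _ x hj
        rw [h1, rfl0_k, hk0 x hx']; simp
      · obtain ⟨z, hz', rfl⟩ := List.mem_map.1 hz
        rw [hE]; exact hge' x hx' z hz'

lemma gen_all (n : ℕ) : ∀ (s t : A → I), PD s t → ∀ y : I → ℤ, 0 ≤ y →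
    eulerForm s t y y = n → Gen s t y := by
  induction n using Nat.strong_induction_on with
  | _ n ih =>
    intro s t hq y hy hn
    have := St.induction hq (fun s' t' σ => 0 ≤ σ y → Gen s' t' (σ y)) ?_ ?_
    · exact this hy
    · intro s' t' σ h hP hs
      rw [h.terminal hq hP y hy hs, map_zero]
      exact ⟨[], by simp, by simp, by simp⟩
    · intro s' t' σ h k hk hkP hM hs
      have hq' := h.pd hq
      by_cases hr : (σ y) k ≤ inc s' t' k (σ y)
      · apply Gen.step0 hq' hk hs
        apply hM
        intro i
        change (0:ℤ) ≤ rfl0 s' t' k (σ y) i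
        by_cases hi : i = k
        · subst hi; rw [rfl0_k]; omega
        · rw [rfl0_ne _ _ _ _ hi]; exact hs i
      · push Not at hr
        set u := σ y with hu
        obtain ⟨r, hr'⟩ : ∃ r : ℕ, (r : ℤ) = u k - inc s' t' k u :=
          ⟨(u k - inc s' t' k u).toNat, by omega⟩
        set y' : I → ℤ := u - r • sm k with hy'
        have hoff : ∀ j, j ≠ k → y' j = u j := by
          intro j hj; simp [hy', sm, hj]
        have hinc : inc s' t' k y' = inc s' t' k u := inc_congr hk hoff
        have hk1 : y' k = inc s' t' k u := by
          simp [hy', sm]; omega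
        have e : u = r • sm k + y' := by rw [hy']; abel
        have hy'0 : 0 ≤ y' := by
          intro i
          by_cases hi : i = k
          · subst hi; rw [hk1]; exact inc_nonneg _ _ _ hs
          · rw [hoff i hi]; exact hs i
        have hz : rfl0 s' t' k y' k = 0 := by rw [rfl0_k, hinc, hk1]; ring
        have hpos : 0 ≤ rfl0 s' t' k y' := by
          intro i
          by_cases hi : i = k
          · subst hi; rw [hz]; rfl
          · rw [rfl0_ne _ _ _ _ hi]; exact hy'0 i
        have hq1 : eulerForm s' t' y' y' < n := by
          have h1 : eulerForm s' t' u u = n := by rw [hu, h.iso, hn]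
          have e' : u = (r : ℤ) • sm k + y' := by rw [e]; simp
          have hl : ∀ z, eulerForm s' t' ((r : ℤ) • sm k) z = r * z k := by
            intro z
            rw [← eF_sm_left t' hk z]
            simp [eulerForm, mul_sub, Finset.mul_sum, mul_assoc]
          have hr2 : eulerForm s' t' y' ((r : ℤ) • sm k) = r * (y' k - inc s' t' k y') := by
            rw [← eF_sm_right]
            simp only [eulerForm, mul_sub, Finset.mul_sum, Pi.smul_apply, smul_eq_mul]
            congr 1 <;> exact Finset.sum_congr rfl fun _ _ => by ring
          rw [e'] at h1
          simp only [eF_add_left, eF_add_right, hl, hr2] at h1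
          rw [hinc, hk1] at h1
          simp only [Pi.smul_apply, smul_eq_mul] at h1
          have : sm k k = 1 := by simp [sm]
          rw [this] at h1
          have hi := inc_nonneg s' t' k hs
          have : (0:ℤ) < r := by omega
          nlinarith
        have hq0 : 0 ≤ eulerForm s' t' y' y' := by
          by_cases h0 : y' = 0
          · rw [h0, eF_zero_left]
          · exact (hq' _ h0).le
        rw [e]
        apply Gen.step1 hq' hk hz hy'0
        refine ih (eulerForm s' t' y' y').toNat (by omega) _ _ (PD_rfl hk hq') _ hpos ?_
        rw [eF_rfl hk]; omega

lemma gen {s t : A → I} (hq : PD s t) {y : I → ℤ} (hy : 0 ≤ y) : Gen s t y := by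
  have hq0 : 0 ≤ eulerForm s t y y := by
    by_cases h0 : y = 0
    · rw [h0, eF_zero_left]
    · exact (hq _ h0).le
  exact gen_all (eulerForm s t y y).toNat s t hq y hy (by omega)

/-! Restrictions to closed vertex sets -/

def res (S : Finset I) (x : I → ℤ) : I → ℤ := fun i => if i ∈ S then x i else 0

lemma res_nonneg (S : Finset I) {x : I → ℤ} (hx : 0 ≤ x) : 0 ≤ res S x := by
  intro i; unfold res; split_ifs
  · exact hx i
  · rfl

lemma supp_of_mem {S : Finset I} {w : I → ℤ} {L : List (I → ℤ)} (hL : ∀ x ∈ L, 0 ≤ x)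
    (hs : L.sum = res S w) {x : I → ℤ} (hx : x ∈ L) {i : I} (hi : i ∉ S) : x i = 0 := by
  have := mem_nonneg_le_sum hL hx i
  rw [hs] at this
  simp only [res, hi, if_false] at this
  exact le_antisymm this (hL x hx i)

lemma sub_dec {s t : A → I} (hq : PD s t) {n : (I → ℤ) → ℕ}
    (hn : ∀ x y, PR s t x → PR s t y → (n x = n y → x = y) ∧
      (n x < n y → 0 ≤ eulerForm s t x y ∧ eulerForm s t y x ≤ 0))
    {w : I → ℤ} (hw : PR s t w) {S : Finset I} (hS : ∀ a, s a ∈ S → t a ∈ S) :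
    ∃ L : List (I → ℤ), L.sum = res S w ∧ ∀ x ∈ L, PR s t x ∧ n x ≤ n w := by
  obtain ⟨L, h1, h2, h3⟩ := gen hq (res_nonneg S hw.1)
  refine ⟨L, h1, fun x hx => ⟨h2 x hx, ?_⟩⟩
  by_contra hlt
  push Not at hlt
  have h4 := ((hn w x hw (h2 x hx)).2 hlt).2
  have h5 : eulerForm s t x w = eulerForm s t x (res S w) := by
    unfold eulerForm
    have hz : ∀ i, i ∉ S → x i = 0 := fun i hi => supp_of_mem (fun x hx => (h2 x hx).1) h1 hx hi
    congr 1
    · refine Finset.sum_congr rfl fun i _ => ?_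
      by_cases hi : i ∈ S
      · simp [res, hi]
      · simp [hz i hi]
    · refine Finset.sum_congr rfl fun a _ => ?_
      by_cases hi : s a ∈ S
      · simp [res, hS a hi]
      · simp [hz _ hi]
  rw [h5, ← h1, eF_sum_right] at h4
  have h6 : eulerForm s t x x ≤ (L.map (fun z => eulerForm s t x z)).sum := by
    apply List.single_le_sum
    · intro c hc
      obtain ⟨z, hz, rfl⟩ := List.mem_map.1 hc
      exact h3 _ hx _ hz
    · exact List.mem_map.2 ⟨_, hx, rfl⟩
  rw [(h2 x hx).2] at h6
  omega

lemma quo_dec {s t : A → I} (hq : PD s t) {n : (I → ℤ) → ℕ}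
    (hn : ∀ x y, PR s t x → PR s t y → (n x = n y → x = y) ∧
      (n x < n y → 0 ≤ eulerForm s t x y ∧ eulerForm s t y x ≤ 0))
    {w : I → ℤ} (hw : PR s t w) {S : Finset I} (hS : ∀ a, t a ∈ S → s a ∈ S) :
    ∃ L : List (I → ℤ), L.sum = res S w ∧ ∀ x ∈ L, PR s t x ∧ n w ≤ n x := by
  obtain ⟨L, h1, h2, h3⟩ := gen hq (res_nonneg S hw.1)
  refine ⟨L, h1, fun x hx => ⟨h2 x hx, ?_⟩⟩
  by_contra hlt
  push Not at hlt
  have h4 := ((hn x w (h2 x hx) hw).2 hlt).2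
  have h5 : eulerForm s t w x = eulerForm s t (res S w) x := by
    unfold eulerForm
    have hz : ∀ i, i ∉ S → x i = 0 := fun i hi => supp_of_mem (fun x hx => (h2 x hx).1) h1 hx hi
    congr 1
    · refine Finset.sum_congr rfl fun i _ => ?_
      by_cases hi : i ∈ S
      · simp [res, hi]
      · simp [hz i hi]
    · refine Finset.sum_congr rfl fun a _ => ?_
      by_cases hi : t a ∈ S
      · simp [res, hS a hi]
      · simp [hz _ hi]
  rw [h5, ← h1, eF_sum_left] at h4
  have h6 : eulerForm s t x x ≤ (L.map (fun z => eulerForm s t z x)).sum := by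
    apply List.single_le_sum
    · intro c hc
      obtain ⟨z, hz, rfl⟩ := List.mem_map.1 hc
      exact h3 _ hz _ hx
    · exact List.mem_map.2 ⟨_, hx, rfl⟩
  rw [(h2 x hx).2] at h6
  omega

lemma pair_nonneg {s t : A → I} {L L' : List (I → ℤ)}
    (h : ∀ x ∈ L, ∀ y ∈ L', 0 ≤ eulerForm s t x y) : 0 ≤ eulerForm s t L.sum L'.sum := by
  rw [eF_sum_left]
  apply List.sum_nonneg
  intro c hc
  obtain ⟨x, hx, rfl⟩ := List.mem_map.1 hc
  rw [eF_sum_right]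
  apply List.sum_nonneg
  intro c hc
  obtain ⟨y, hy, rfl⟩ := List.mem_map.1 hc
  exact h x hx y hy

lemma pair_nonpos {s t : A → I} {L L' : List (I → ℤ)}
    (h : ∀ x ∈ L, ∀ y ∈ L', eulerForm s t x y ≤ 0) : eulerForm s t L.sum L'.sum ≤ 0 := by
  have e : eulerForm s t L.sum L'.sum = - (L.map (fun y => - eulerForm s t y L'.sum)).sum := by
    rw [eF_sum_left]
    clear h
    induction L with
    | nil => simp
    | cons a L ih => simp only [List.map_cons, List.sum_cons, ih]; ring
  rw [e]
  simp only [Left.neg_nonpos_iff]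
  apply List.sum_nonneg
  intro c hc
  obtain ⟨x, hx, rfl⟩ := List.mem_map.1 hc
  rw [← eF_neg_left, eF_sum_right]
  apply List.sum_nonneg
  intro c hc
  obtain ⟨y, hy, rfl⟩ := List.mem_map.1 hc
  rw [eF_neg_left]
  have := h x hx y hy
  simp only [Left.nonneg_neg_iff]
  exact this

/-! Forest combinatorics -/

/-- arrows inside X -/
def ins (s t : A → I) (X : Finset I) : Finset A := Finset.univ.filter (fun a => s a ∈ X ∧ t a ∈ X)

lemma conn_reduce (s t : A → I) (φ : Finset I → ℤ)
    (hadd : ∀ X Y : Finset I, Disjoint X Y →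
      (∀ a, ¬ (s a ∈ X ∧ t a ∈ Y) ∧ ¬ (s a ∈ Y ∧ t a ∈ X)) → φ (X ∪ Y) = φ X + φ Y)
    (hc : ∀ X : Finset I, X.card ≤ (ins s t X).card + 1 → 0 ≤ φ X) : ∀ U, 0 ≤ φ U := by
  intro U
  induction U using Finset.strongInduction with
  | _ U ih =>
    by_cases hU : U = ∅
    · apply hc; simp [hU]
    obtain ⟨u, hu⟩ := Finset.nonempty_iff_ne_empty.2 hU
    set F := U.powerset.filter (fun X => X.Nonempty ∧ X.card ≤ (ins s t X).card + 1) with hF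
    have hFn : F.Nonempty := ⟨{u}, by simp [hF, hu]⟩
    obtain ⟨X, hX, hmax⟩ := Finset.exists_max_image F Finset.card hFn
    simp only [hF, Finset.mem_filter, Finset.mem_powerset] at hX
    obtain ⟨hXU, hXn, hXc⟩ := hX
    by_cases hXe : X = U
    · subst hXe; exact hc _ hXc
    have hgrow : ∀ j ∈ U, j ∉ X → (∃ a, (s a ∈ X ∧ t a = j) ∨ (s a = j ∧ t a ∈ X)) → False := by
      rintro j hjU hjX ⟨a, ha⟩
      have hm := hmax (insert j X) (by
        simp only [hF, Finset.mem_filter, Finset.mem_powerset]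
        refine ⟨Finset.insert_subset hjU hXU, by simp, ?_⟩
        rw [Finset.card_insert_of_notMem hjX]
        have hsub : insert a (ins s t X) ⊆ ins s t (insert j X) := by
          intro b hb
          rcases Finset.mem_insert.1 hb with rfl | hb
          · simp only [ins, Finset.mem_filter, Finset.mem_univ, true_and, Finset.mem_insert]
            tauto
          · simp only [ins, Finset.mem_filter, Finset.mem_univ, true_and, Finset.mem_insert] at hb ⊢
            tauto
        have hna : a ∉ ins s t X := by
          simp only [ins, Finset.mem_filter, Finset.mem_univ, true_and]
          rcases ha with ⟨_, h⟩ | ⟨h, _⟩ <;> rw [h] <;> tauto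
        have := Finset.card_le_card hsub
        rw [Finset.card_insert_of_notMem hna] at this
        omega)
      rw [Finset.card_insert_of_notMem hjX] at hm
      omega
    have e : U = X ∪ (U \ X) := (Finset.union_sdiff_of_subset hXU).symm
    rw [e, hadd X (U \ X) Finset.disjoint_sdiff]
    · have h1 := ih X (Finset.ssubset_iff_subset_ne.2 ⟨hXU, hXe⟩)
      have h2 := ih (U \ X) (Finset.sdiff_ssubset hXU hXn)
      omega
    · intro a
      simp only [Finset.mem_sdiff]
      exact ⟨fun h => hgrow _ h.2.1 h.2.2 ⟨a, Or.inl ⟨h.1, rfl⟩⟩,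
        fun h => hgrow _ h.1.1 h.1.2 ⟨a, Or.inr ⟨rfl, h.2⟩⟩⟩

/-- closures of a connected set in a forest -/
lemma closures {s t : A → I} (hq : PD s t) (C : Finset I) (hC : C.card ≤ (ins s t C).card + 1) :
    ∃ S R : Finset I, (∀ a, s a ∈ S → t a ∈ S) ∧ (∀ a, t a ∈ R → s a ∈ R) ∧ S ∩ R = C ∧
      ∀ a, s a ∈ R → t a ∈ S → s a ∈ C ∨ t a ∈ C := by
  set r : I → I → Prop := fun i j => ∃ a, s a = i ∧ t a = j with hr
  set S : Finset I := Finset.univ.filter (fun j => ∃ i ∈ C, Relation.ReflTransGen r i j) with hS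
  set R : Finset I := Finset.univ.filter (fun j => ∃ i ∈ C, Relation.ReflTransGen r j i) with hR
  have mS : ∀ j, j ∈ S ↔ ∃ i ∈ C, Relation.ReflTransGen r i j := by simp [hS]
  have mR : ∀ j, j ∈ R ↔ ∃ i ∈ C, Relation.ReflTransGen r j i := by simp [hR]
  have cS : ∀ a, s a ∈ S → t a ∈ S := by
    intro a ha
    obtain ⟨i, hi, hp⟩ := (mS _).1 ha
    exact (mS _).2 ⟨i, hi, hp.tail ⟨a, rfl, rfl⟩⟩
  have cR : ∀ a, t a ∈ R → s a ∈ R := by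
    intro a ha
    obtain ⟨i, hi, hp⟩ := (mR _).1 ha
    exact (mR _).2 ⟨i, hi, hp.head ⟨a, rfl, rfl⟩⟩
  have CS : C ⊆ S := fun i hi => (mS _).2 ⟨i, hi, .refl⟩
  have CR : C ⊆ R := fun i hi => (mR _).2 ⟨i, hi, .refl⟩
  have iS : ∀ j ∈ S, j ∉ C → ∃ a, t a = j ∧ s a ∈ S := by
    intro j hj hjC
    obtain ⟨i, hi, hp⟩ := (mS _).1 hj
    rcases Relation.ReflTransGen.cases_tail hp with h | ⟨b, hb, a, ha, ha'⟩
    · exact absurd (h ▸ hi) hjC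
    · exact ⟨a, ha', by rw [ha]; exact (mS _).2 ⟨i, hi, hb⟩⟩
  have iR : ∀ j ∈ R, j ∉ C → ∃ a, s a = j ∧ t a ∈ R := by
    intro j hj hjC
    obtain ⟨i, hi, hp⟩ := (mR _).1 hj
    rcases Relation.ReflTransGen.cases_head hp with h | ⟨b, ⟨a, ha, ha'⟩, hb⟩
    · exact absurd (h ▸ hi) hjC
    · exact ⟨a, ha, by rw [ha']; exact (mR _).2 ⟨i, hi, hb⟩⟩
  have hSR : S ∩ R = C := by
    by_contra hne
    set X := S ∩ R with hX
    have hCX : C ⊆ X := Finset.subset_inter CS CR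
    have hD : (X \ C).Nonempty := by
      rw [Finset.sdiff_nonempty]
      intro h; exact hne (Finset.Subset.antisymm h hCX)
    -- an arrow from X \ C to C
    have hout : ∃ a, s a ∈ X \ C ∧ t a ∈ C := by
      by_contra! hno
      have hlt := count hq (X \ C) hD
      have : (X \ C).card ≤ (Finset.univ.filter (fun a => s a ∈ X \ C ∧ t a ∈ X \ C)).card := by
        apply Finset.card_le_card_of_surjOn s
        intro j hj
        have hj' : j ∈ X \ C := hj
        simp only [hX, Finset.mem_sdiff, Finset.mem_inter] at hj'
        obtain ⟨a, ha, hat⟩ := iR j hj'.1.2 hj'.2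
        have h1 : s a ∈ X \ C := by rw [ha]; exact hj
        refine ⟨a, ?_, ha⟩
        have h2 : t a ∈ S := cS a (by rw [ha]; exact hj'.1.1)
        simp only [Finset.coe_filter, Finset.mem_univ, true_and, Set.mem_ofPred_eq]
        exact ⟨h1, Finset.mem_sdiff.2 ⟨Finset.mem_inter.2 ⟨h2, hat⟩, hno a h1⟩⟩
      omega
    obtain ⟨a0, ha0, ha0'⟩ := hout
    have hlt := count hq X (hD.mono Finset.sdiff_subset)
    set E2 := Finset.univ.filter (fun a => s a ∈ X ∧ t a ∈ X \ C) with hE2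
    have c2 : (X \ C).card ≤ E2.card := by
      apply Finset.card_le_card_of_surjOn t
      intro j hj
      have hj' : j ∈ X \ C := hj
      simp only [hX, Finset.mem_sdiff, Finset.mem_inter] at hj'
      obtain ⟨a, ha, hat⟩ := iS j hj'.1.1 hj'.2
      refine ⟨a, ?_, ha⟩
      have h2 : s a ∈ R := cR a (by rw [ha]; exact hj'.1.2)
      simp only [hE2, Finset.coe_filter, Finset.mem_univ, true_and, Set.mem_ofPred_eq]
      exact ⟨Finset.mem_inter.2 ⟨hat, h2⟩, by rw [ha]; exact hj⟩
    have d1 : Disjoint (ins s t C) E2 := by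
      rw [Finset.disjoint_left]
      intro a h1 h2
      simp only [ins, hE2, Finset.mem_filter, Finset.mem_univ, true_and, Finset.mem_sdiff] at h1 h2
      exact h2.2.2 h1.2
    have d2 : a0 ∉ ins s t C ∪ E2 := by
      simp only [ins, hE2, Finset.mem_union, Finset.mem_filter, Finset.mem_univ, true_and,
        Finset.mem_sdiff] at ha0 ⊢
      tauto
    have hsub : insert a0 (ins s t C ∪ E2) ⊆ Finset.univ.filter (fun a => s a ∈ X ∧ t a ∈ X) := by
      intro b hb
      simp only [Finset.mem_filter, Finset.mem_univ, true_and]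
      rcases Finset.mem_insert.1 hb with rfl | hb
      · exact ⟨(Finset.mem_sdiff.1 ha0).1, hCX ha0'⟩
      · rcases Finset.mem_union.1 hb with hb | hb
        · simp only [ins, Finset.mem_filter, Finset.mem_univ, true_and] at hb
          exact ⟨hCX hb.1, hCX hb.2⟩
        · simp only [hE2, Finset.mem_filter, Finset.mem_univ, true_and, Finset.mem_sdiff] at hb
          exact ⟨hb.1, hb.2.1⟩
    have := Finset.card_le_card hsub
    rw [Finset.card_insert_of_notMem d2, Finset.card_union_of_disjoint d1] at this
    have := Finset.card_sdiff_add_card_eq_card hCX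
    omega
  refine ⟨S, R, cS, cR, hSR, ?_⟩
  intro a0 h1 h2
  by_contra! hno
  have hnS : s a0 ∉ S := fun h => hno.1 (by rw [← hSR]; exact Finset.mem_inter.2 ⟨h, h1⟩)
  have hnR : t a0 ∉ R := fun h => hno.2 (by rw [← hSR]; exact Finset.mem_inter.2 ⟨h2, h⟩)
  have hSRC : ∀ j, j ∈ S → j ∈ R → j ∈ C := fun j h h' => by
    rw [← hSR]; exact Finset.mem_inter.2 ⟨h, h'⟩
  have hlt := count hq (S ∪ R) ⟨t a0, Finset.mem_union_left _ h2⟩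
  set E2 := Finset.univ.filter (fun a => s a ∈ S ∧ t a ∈ S \ C) with hE2
  set E3 := Finset.univ.filter (fun a => s a ∈ R \ C ∧ t a ∈ R) with hE3
  have c2 : (S \ C).card ≤ E2.card := by
    apply Finset.card_le_card_of_surjOn t
    intro j hj
    have hj' : j ∈ S \ C := hj
    rw [Finset.mem_sdiff] at hj'
    obtain ⟨a, ha, hat⟩ := iS j hj'.1 hj'.2
    refine ⟨a, ?_, ha⟩
    simp only [hE2, Finset.coe_filter, Finset.mem_univ, true_and, Set.mem_ofPred_eq]
    exact ⟨hat, by rw [ha]; exact hj⟩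
  have c3 : (R \ C).card ≤ E3.card := by
    apply Finset.card_le_card_of_surjOn s
    intro j hj
    have hj' : j ∈ R \ C := hj
    rw [Finset.mem_sdiff] at hj'
    obtain ⟨a, ha, hat⟩ := iR j hj'.1 hj'.2
    refine ⟨a, ?_, ha⟩
    simp only [hE3, Finset.coe_filter, Finset.mem_univ, true_and, Set.mem_ofPred_eq]
    exact ⟨by rw [ha]; exact hj, hat⟩
  have d1 : Disjoint (ins s t C) E2 := by
    rw [Finset.disjoint_left]
    intro a h1 h2
    simp only [ins, hE2, Finset.mem_filter, Finset.mem_univ, true_and, Finset.mem_sdiff] at h1 h2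
    exact h2.2.2 h1.2
  have d2 : Disjoint (ins s t C ∪ E2) E3 := by
    rw [Finset.disjoint_left]
    intro a h1 h2
    simp only [ins, hE2, hE3, Finset.mem_union, Finset.mem_filter, Finset.mem_univ, true_and,
      Finset.mem_sdiff] at h1 h2
    rcases h1 with h1 | h1
    · exact h2.1.2 h1.1
    · exact h2.1.2 (hSRC _ h1.1 h2.1.1)
  have d3 : a0 ∉ ins s t C ∪ E2 ∪ E3 := by
    simp only [ins, hE2, hE3, Finset.mem_union, Finset.mem_filter, Finset.mem_univ, true_and,
      Finset.mem_sdiff]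
    tauto
  have hsub : insert a0 (ins s t C ∪ E2 ∪ E3) ⊆
      Finset.univ.filter (fun a => s a ∈ S ∪ R ∧ t a ∈ S ∪ R) := by
    intro b hb
    simp only [ins, hE2, hE3, Finset.mem_insert, Finset.mem_union, Finset.mem_filter,
      Finset.mem_univ, true_and, Finset.mem_sdiff] at hb ⊢
    rcases hb with rfl | (hb | hb) | hb
    · exact ⟨Or.inr h1, Or.inl h2⟩
    · exact ⟨Or.inl (CS hb.1), Or.inl (CS hb.2)⟩
    · exact ⟨Or.inl hb.1, Or.inl hb.2.1⟩
    · exact ⟨Or.inr hb.1.1, Or.inr hb.2⟩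
  have k1 := Finset.card_le_card hsub
  rw [Finset.card_insert_of_notMem d3, Finset.card_union_of_disjoint d2,
    Finset.card_union_of_disjoint d1] at k1
  have k2 := Finset.card_sdiff_add_card_eq_card CS
  have k3 := Finset.card_sdiff_add_card_eq_card CR
  have k4 := Finset.card_union_add_card_inter S R
  rw [hSR] at k4
  omega

/-! ### Subset inequality -/
def phi1 (s t : A → I) (w v : I → ℤ) (U : Finset I) : ℤ :=
  (∑ i, if i ∈ U then w i * v i else 0) - ∑ a, if s a ∈ U ∧ t a ∈ U then w (s a) * v (t a) else 0

def phi2 (s t : A → I) (w v : I → ℤ) (U : Finset I) : ℤ :=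
  (∑ a, if s a ∈ U ∨ t a ∈ U then w (s a) * v (t a) else 0) - ∑ i, if i ∈ U then w i * v i else 0

lemma sum_vert_add (w v : I → ℤ) {X Y : Finset I} (h : Disjoint X Y) :
    (∑ i, if i ∈ X ∪ Y then w i * v i else 0) =
      (∑ i, if i ∈ X then w i * v i else 0) + ∑ i, if i ∈ Y then w i * v i else 0 := by
  rw [← Finset.sum_add_distrib]
  refine Finset.sum_congr rfl fun i _ => ?_
  have hd : i ∈ X → i ∉ Y := fun hi => Finset.disjoint_left.1 h hi
  by_cases h1 : i ∈ X <;> by_cases h2 : i ∈ Y <;> simp_all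

lemma phi1_add (s t : A → I) (w v : I → ℤ) (X Y : Finset I) (h : Disjoint X Y)
    (hxy : ∀ a, ¬ (s a ∈ X ∧ t a ∈ Y) ∧ ¬ (s a ∈ Y ∧ t a ∈ X)) :
    phi1 s t w v (X ∪ Y) = phi1 s t w v X + phi1 s t w v Y := by
  unfold phi1
  rw [sum_vert_add w v h]
  have : (∑ a, if s a ∈ X ∪ Y ∧ t a ∈ X ∪ Y then w (s a) * v (t a) else 0) =
      (∑ a, if s a ∈ X ∧ t a ∈ X then w (s a) * v (t a) else 0) +
        ∑ a, if s a ∈ Y ∧ t a ∈ Y then w (s a) * v (t a) else 0 := by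
    rw [← Finset.sum_add_distrib]
    refine Finset.sum_congr rfl fun a _ => ?_
    have hd : s a ∈ X → s a ∉ Y := fun hi => Finset.disjoint_left.1 h hi
    have hd' : t a ∈ X → t a ∉ Y := fun hi => Finset.disjoint_left.1 h hi
    have := hxy a
    by_cases h1 : s a ∈ X <;> by_cases h2 : s a ∈ Y <;> by_cases h3 : t a ∈ X <;>
      by_cases h4 : t a ∈ Y <;> simp_all
  rw [this]; ring

lemma phi2_add (s t : A → I) (w v : I → ℤ) (X Y : Finset I) (h : Disjoint X Y)
    (hxy : ∀ a, ¬ (s a ∈ X ∧ t a ∈ Y) ∧ ¬ (s a ∈ Y ∧ t a ∈ X)) :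
    phi2 s t w v (X ∪ Y) = phi2 s t w v X + phi2 s t w v Y := by
  unfold phi2
  rw [sum_vert_add w v h]
  have : (∑ a, if s a ∈ X ∪ Y ∨ t a ∈ X ∪ Y then w (s a) * v (t a) else 0) =
      (∑ a, if s a ∈ X ∨ t a ∈ X then w (s a) * v (t a) else 0) +
        ∑ a, if s a ∈ Y ∨ t a ∈ Y then w (s a) * v (t a) else 0 := by
    rw [← Finset.sum_add_distrib]
    refine Finset.sum_congr rfl fun a _ => ?_
    have hd : s a ∈ X → s a ∉ Y := fun hi => Finset.disjoint_left.1 h hi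
    have hd' : t a ∈ X → t a ∉ Y := fun hi => Finset.disjoint_left.1 h hi
    have := hxy a
    by_cases h1 : s a ∈ X <;> by_cases h2 : s a ∈ Y <;> by_cases h3 : t a ∈ X <;>
      by_cases h4 : t a ∈ Y <;> simp_all
  rw [this]; ring

lemma phi_compl (s t : A → I) (w v : I → ℤ) (U : Finset I) :
    phi1 s t w v U = eulerForm s t w v + phi2 s t w v Uᶜ := by
  unfold phi1 phi2 eulerForm
  have e1 : (∑ i, w i * v i) = (∑ i, if i ∈ U then w i * v i else 0) +
      ∑ i, if i ∈ Uᶜ then w i * v i else 0 := by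
    rw [← Finset.sum_add_distrib]
    refine Finset.sum_congr rfl fun i _ => ?_
    by_cases h : i ∈ U <;> simp [h]
  have e2 : (∑ a, w (s a) * v (t a)) =
      (∑ a, if s a ∈ U ∧ t a ∈ U then w (s a) * v (t a) else 0) +
      ∑ a, if s a ∈ Uᶜ ∨ t a ∈ Uᶜ then w (s a) * v (t a) else 0 := by
    rw [← Finset.sum_add_distrib]
    refine Finset.sum_congr rfl fun a _ => ?_
    by_cases h : s a ∈ U <;> by_cases h' : t a ∈ U <;> simp [h, h']
  rw [e1, e2]; ring

lemma subset_ineq {s t : A → I} (hq : PD s t) {v w : I → ℤ} (hv : PR s t v) (hw : PR s t w)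
    (U : Finset I) : - phi1 s t w v U ≤ max 0 (- eulerForm s t w v) := by
  obtain ⟨n, hn⟩ := exists_order hq
  rcases le_or_gt (n w) (n v) with hle | hlt
  · have : 0 ≤ phi1 s t w v U := by
      refine conn_reduce s t _ (phi1_add s t w v) (fun C hC => ?_) U
      obtain ⟨S, R, hS, hR, hSR, -⟩ := closures hq C hC
      obtain ⟨L, h1, h2⟩ := sub_dec hq hn hw hS
      obtain ⟨L', h1', h2'⟩ := quo_dec hq hn hv hR
      have key : 0 ≤ eulerForm s t L.sum L'.sum := by
        refine pair_nonneg fun x hx y hy => ?_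
        obtain ⟨hx1, hx2⟩ := h2 x hx
        obtain ⟨hy1, hy2⟩ := h2' y hy
        rcases (hx2.trans (hle.trans hy2)).lt_or_eq with h | h
        · exact ((hn x y hx1 hy1).2 h).1
        · have := (hn x y hx1 hy1).1 h
          subst this
          rw [hx1.2]; norm_num
      rw [h1, h1'] at key
      have e : eulerForm s t (res S w) (res R v) = phi1 s t w v C := by
        unfold eulerForm phi1 res
        congr 1
        · refine Finset.sum_congr rfl fun i _ => ?_
          rw [← hSR]
          by_cases h : i ∈ S <;> by_cases h' : i ∈ R <;> simp [h, h']
        · refine Finset.sum_congr rfl fun a _ => ?_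
          rw [← hSR]
          have g1 := hS a
          have g2 := hR a
          clear hSR hS hR hn h2 h2'
          by_cases h : s a ∈ S <;> by_cases h' : t a ∈ R <;> simp_all
      rwa [e] at key
    exact le_max_of_le_left (by linarith)
  · have : 0 ≤ phi2 s t w v Uᶜ := by
      refine conn_reduce s t _ (phi2_add s t w v) (fun C hC => ?_) Uᶜ
      obtain ⟨S, R, hS, hR, hSR, hC2⟩ := closures hq C hC
      obtain ⟨L, h1, h2⟩ := quo_dec hq hn hw hR
      obtain ⟨L', h1', h2'⟩ := sub_dec hq hn hv hS
      have key : eulerForm s t L.sum L'.sum ≤ 0 := by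
        refine pair_nonpos fun x hx y hy => ?_
        obtain ⟨hx1, hx2⟩ := h2 x hx
        obtain ⟨hy1, hy2⟩ := h2' y hy
        exact ((hn y x hy1 hx1).2 (by omega)).2
      rw [h1, h1'] at key
      have e : eulerForm s t (res R w) (res S v) = - phi2 s t w v C := by
        unfold eulerForm phi2 res
        rw [neg_sub]
        congr 1
        · refine Finset.sum_congr rfl fun i _ => ?_
          rw [← hSR]
          by_cases h : i ∈ S <;> by_cases h' : i ∈ R <;> simp [h, h']
        · refine Finset.sum_congr rfl fun a _ => ?_
          have q1 := hC2 a
          rw [← hSR] at q1 ⊢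
          have g1 := hS a
          have g2 := hR a
          clear hSR hS hR hn h2 h2' hC2
          by_cases h : s a ∈ R <;> by_cases h' : t a ∈ S <;> simp_all
      rw [e] at key
      linarith
    rw [phi_compl]
    exact le_max_of_le_right (by linarith)

/-! ### Box reduction -/
def Psi (s t : A → I) (w v : I → ℤ) (u : I → ℝ) : ℝ :=
  -(∑ i, (v i : ℝ) * w i * u i) + ∑ a, (w (s a) : ℝ) * v (t a) * (u (s a) * u (t a))

lemma Psi_affine {s t : A → I} (hl : ∀ a, s a ≠ t a) (w v : I → ℤ) (u : I → ℝ) (k : I) :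
    Psi s t w v u = (1 - u k) * Psi s t w v (Function.update u k 0) +
      u k * Psi s t w v (Function.update u k 1) := by
  unfold Psi
  have e1 : (∑ i, (v i : ℝ) * w i * u i) =
      (1 - u k) * (∑ i, (v i : ℝ) * w i * Function.update u k 0 i) +
      u k * (∑ i, (v i : ℝ) * w i * Function.update u k 1 i) := by
    rw [Finset.mul_sum, Finset.mul_sum, ← Finset.sum_add_distrib]
    refine Finset.sum_congr rfl fun i _ => ?_
    by_cases h : i = k
    · subst h; simp; ring
    · simp [h]; ring
  have e2 : (∑ a, (w (s a) : ℝ) * v (t a) * (u (s a) * u (t a))) =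
      (1 - u k) * (∑ a, (w (s a) : ℝ) * v (t a) *
        (Function.update u k 0 (s a) * Function.update u k 0 (t a))) +
      u k * (∑ a, (w (s a) : ℝ) * v (t a) *
        (Function.update u k 1 (s a) * Function.update u k 1 (t a))) := by
    rw [Finset.mul_sum, Finset.mul_sum, ← Finset.sum_add_distrib]
    refine Finset.sum_congr rfl fun a _ => ?_
    have := hl a
    by_cases h : s a = k
    · have h' : t a ≠ k := fun h' => this (h.trans h'.symm)
      simp [h, h']; ring
    · by_cases h' : t a = k
      · simp [h, h']; ring
      · simp [h, h']; ring
  rw [e1, e2]; ring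

lemma Psi_ind (s t : A → I) (w v : I → ℤ) (U : Finset I) :
    Psi s t w v (fun i => if i ∈ U then 1 else 0) = ((- phi1 s t w v U : ℤ) : ℝ) := by
  unfold Psi phi1
  push_cast
  have e1 : (∑ i, (v i : ℝ) * w i * (if i ∈ U then (1:ℝ) else 0)) =
      ∑ i, if i ∈ U then (w i : ℝ) * v i else 0 := by
    refine Finset.sum_congr rfl fun i _ => ?_
    by_cases h : i ∈ U <;> simp [h, mul_comm]
  have e2 : (∑ a, (w (s a) : ℝ) * v (t a) *
      ((if s a ∈ U then (1:ℝ) else 0) * (if t a ∈ U then (1:ℝ) else 0))) =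
      ∑ a, if s a ∈ U ∧ t a ∈ U then (w (s a) : ℝ) * v (t a) else 0 := by
    refine Finset.sum_congr rfl fun a _ => ?_
    by_cases h : s a ∈ U <;> by_cases h' : t a ∈ U <;> simp [h, h']
  rw [e1, e2]; ring

lemma Psi_box {s t : A → I} (hl : ∀ a, s a ≠ t a) (w v : I → ℤ) (M : ℝ)
    (hM : ∀ U : Finset I, Psi s t w v (fun i => if i ∈ U then 1 else 0) ≤ M)
    (T : Finset I) : ∀ u : I → ℝ, (∀ i, 0 ≤ u i ∧ u i ≤ 1) → (∀ i, i ∉ T → u i = 0 ∨ u i = 1) →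
      Psi s t w v u ≤ M := by
  induction T using Finset.induction_on with
  | empty =>
    intro u _ h
    have : u = fun i => if i ∈ Finset.univ.filter (fun i => u i = 1) then 1 else 0 := by
      funext i
      rcases h i (by simp) with h | h <;> simp [h]
    rw [this]; exact hM _
  | insert k T hk ih =>
    intro u h01 h
    have h0 := ih (Function.update u k 0) (by
      intro i; by_cases hi : i = k
      · subst hi; simp
      · simpa [hi] using h01 i) (by
      intro i hiT; by_cases hi : i = k
      · subst hi; simp
      · simpa [hi] using h i (by simp [hi, hiT]))
    have h1 := ih (Function.update u k 1) (by
      intro i; by_cases hi : i = k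
      · subst hi; simp
      · simpa [hi] using h01 i) (by
      intro i hiT; by_cases hi : i = k
      · subst hi; simp
      · simpa [hi] using h i (by simp [hi, hiT]))
    rw [Psi_affine hl w v u k]
    have := h01 k
    nlinarith [mul_le_mul_of_nonneg_left h0 (sub_nonneg.2 this.2),
      mul_le_mul_of_nonneg_left h1 this.1]

lemma box_le {s t : A → I} (w v : I → ℤ) (hw : 0 ≤ w) (hv : 0 ≤ v) (p r : I → ℝ)
    (hp : ∀ i, 0 ≤ p i ∧ p i ≤ 1) (hr : ∀ i, 0 ≤ r i ∧ r i ≤ 1) :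
    -(∑ i, (((v i : ℝ) * p i) * (w i : ℝ) + (v i : ℝ) * ((w i : ℝ) * r i)
        - ((v i : ℝ) * p i) * ((w i : ℝ) * r i))) +
      ∑ a, ((v (t a) : ℝ) * p (t a)) * ((w (s a) : ℝ) * r (s a)) ≤
    Psi s t w v (fun i => max (p i) (r i)) := by
  have hw' : ∀ i, (0:ℝ) ≤ w i := fun i => by exact_mod_cast hw i
  have hv' : ∀ i, (0:ℝ) ≤ v i := fun i => by exact_mod_cast hv i
  unfold Psi
  refine add_le_add (neg_le_neg (Finset.sum_le_sum fun i _ => ?_))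
    (Finset.sum_le_sum fun a _ => ?_)
  · have h1 : max (p i) (r i) ≤ p i + r i - p i * r i := by
      have := hp i
      have := hr i
      apply max_le <;> nlinarith
    nlinarith [mul_le_mul_of_nonneg_left h1 (mul_nonneg (hv' i) (hw' i))]
  · have h1 : r (s a) * p (t a) ≤ max (p (s a)) (r (s a)) * max (p (t a)) (r (t a)) :=
      mul_le_mul (le_max_right _ _) (le_max_left _ _) (hp _).1 (le_max_of_le_right (hr _).1)
    nlinarith [mul_le_mul_of_nonneg_left h1 (mul_nonneg (hw' (s a)) (hv' (t a)))]

end Helpers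

/-- for positive roots `v, w` and real vectors `0 ≤ v' ≤ v`, `0 ≤ w' ≤ w`,
we have `-Σ_i (v'_i w_i + v_i w'_i - v'_i w'_i) + Σ_{arrows j→i} v'_i w'_j ≤
max(0, -⟨w,v⟩)`. -/
theorem stmt4
    (I A : Type) [Fintype I] [Fintype A] (s t : A → I)
    (hNoLoops : ∀ a, s a ≠ t a)
    (hPosDef : ∀ v : I → ℝ, v ≠ 0 → 0 < eulerFormR s t v v + eulerFormR s t v v)
    (v w : I → ℕ) (hv : IsPosRoot s t v) (hw : IsPosRoot s t w)
    (v' w' : I → ℝ)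
    (hv' : ∀ i, 0 ≤ v' i ∧ v' i ≤ (v i : ℝ))
    (hw' : ∀ i, 0 ≤ w' i ∧ w' i ≤ (w i : ℝ)) :
    -(∑ i, (v' i * (w i : ℝ) + (v i : ℝ) * w' i - v' i * w' i)) +
      ∑ a, v' (t a) * w' (s a) ≤ max 0 (-(eulerN s t w v : ℝ)) := by
  classical
  have hq : PD s t := by
    intro x hx
    have h := hPosDef (fun i => (x i : ℝ)) (by
      intro h0; apply hx; funext i
      have := congrFun h0 i
      simpa using this)
    have e : eulerFormR s t (fun i => (x i : ℝ)) (fun i => (x i : ℝ)) =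
        ((eulerForm s t x x : ℤ) : ℝ) := by
      unfold eulerFormR eulerForm; push_cast; rfl
    rw [e] at h
    have h2 : (0:ℝ) < ((eulerForm s t x x : ℤ) : ℝ) := by linarith
    exact_mod_cast h2
  have hV : PR s t (fun i => (v i : ℤ)) := by
    refine ⟨fun i => by simp, ?_⟩
    have := hv.2
    unfold eulerN at this
    omega
  have hW : PR s t (fun i => (w i : ℤ)) := by
    refine ⟨fun i => by simp, ?_⟩
    have := hw.2
    unfold eulerN at this
    omega
  have hpe : ∀ (x : ℕ) (y : ℝ), 0 ≤ y ∧ y ≤ (x : ℝ) →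
      (0 ≤ y / x ∧ y / x ≤ 1) ∧ y = (((x : ℤ) : ℝ)) * (y / x) := by
    intro x y h
    rcases Nat.eq_zero_or_pos x with h0 | h0
    · subst h0
      have : y = 0 := le_antisymm (by simpa using h.2) h.1
      simp [this]
    · have hx : (0:ℝ) < x := by exact_mod_cast h0
      refine ⟨⟨div_nonneg h.1 hx.le, (div_le_one hx).2 h.2⟩, ?_⟩
      push_cast
      field_simp
  have hp := fun i => hpe (v i) (v' i) (hv' i)
  have hr := fun i => hpe (w i) (w' i) (hw' i)
  have key := box_le (s := s) (t := t) (fun i => (w i : ℤ)) (fun i => (v i : ℤ)) hW.1 hV.1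
    (fun i => v' i / v i) (fun i => w' i / w i) (fun i => (hp i).1) (fun i => (hr i).1)
  have key2 := Psi_box hNoLoops (fun i => (w i : ℤ)) (fun i => (v i : ℤ))
    (max 0 (-(eulerN s t w v : ℝ))) (by
      intro U
      rw [Psi_ind]
      have := subset_ineq hq hV hW U
      have h2 : ((- phi1 s t (fun i => (w i : ℤ)) (fun i => (v i : ℤ)) U : ℤ) : ℝ) ≤
        ((max 0 (- eulerForm s t (fun i => (w i : ℤ)) (fun i => (v i : ℤ))) : ℤ) : ℝ) := by
        exact_mod_cast this
      refine h2.trans (le_of_eq ?_)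
      unfold eulerN
      push_cast
      rfl) Finset.univ (fun i => max (v' i / v i) (w' i / w i))
      (fun i => ⟨le_max_of_le_left (hp i).1.1, max_le (hp i).1.2 (hr i).1.2⟩) (by simp)
  refine le_trans (le_of_eq ?_) (key.trans key2)
  have e1 : ∀ i, (v i : ℝ) * (v' i / v i) = v' i := fun i => by
    have := (hp i).2.symm
    rwa [Int.cast_natCast] at this
  have e2 : ∀ i, (w i : ℝ) * (w' i / w i) = w' i := fun i => by
    have := (hr i).2.symm
    rwa [Int.cast_natCast] at this
  simp only [Int.cast_natCast, e1, e2]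

end ADEShuffle
end
end

section
/- For all v, w ∈ ℕ^I the following identity holds in ℚ(q)(x,y): ∏_{i,j∈I} [ ζ_{ji}( (y q^{τ(j)}) / (x q^{τ(i)}) ) / ζ_{ij}( (x q^{τ(i)}) / (y q^{τ(j)}) ) ]^{v_i w_j} = ( (x−y)/(xq − yq^{−1}) )^{⟨v,w⟩} · ( (xq^{−1} − yq)/(x−y) )^{⟨w,v⟩}. In particular, if ⟨v,w⟩ = −1 and ⟨w,v⟩ = 0, the left-hand side equals (xq − yq^{−1})/(x − y). -/
noncomputable section

namespace ADEShuffle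

/-- The `i`-th coordinate vector `ς^i ∈ ℤ^I`. -/
def coordVec {I : Type} [DecidableEq I] (i : I) : I → ℤ := fun j => if j = i then 1 else 0

/-- The symmetrized Euler form `(ς^i, ς^j)` of two coordinate vectors: it equals `2`
if `i = j`, `-1` if `i` and `j` are adjacent, and `0` otherwise. -/
def coordPair {I A : Type} [Fintype I] [Fintype A] [DecidableEq I] (s t : A → I)
    (i j : I) : ℤ :=
  eulerForm s t (coordVec i) (coordVec j) + eulerForm s t (coordVec j) (coordVec i)

/-- The field `ℚ(q)`. -/
abbrev Fq : Type := RatFunc ℚ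

/-- The field `ℚ(q)(x)`. -/
abbrev Fqx : Type := RatFunc Fq

/-- The field `ℚ(q)(x,y) = ℚ(q)(x)(y)`. -/
abbrev Fqxy : Type := RatFunc Fqx

/-- `q` as an element of `ℚ(q)(x,y)`. -/
def qE : Fqxy := RatFunc.C (RatFunc.C RatFunc.X)

/-- `x` as an element of `ℚ(q)(x,y)`. -/
def xE : Fqxy := RatFunc.C RatFunc.X

/-- `y` as an element of `ℚ(q)(x,y)`. -/
def yE : Fqxy := RatFunc.X

/-- The function `ζ_{ij}(z) = (z - q^{-(ς^i,ς^j)})/(z - 1)`, evaluated at `u ∈ ℚ(q)(x,y)`. -/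
def zetaE {I A : Type} [Fintype I] [Fintype A] [DecidableEq I] (s t : A → I)
    (i j : I) (u : Fqxy) : Fqxy :=
  (u - qE ^ (-(coordPair s t i j))) / (u - 1)

/-- The matrix of the Euler form. -/
def eM {I A : Type} [Fintype I] [Fintype A] [DecidableEq I] (s t : A → I) (i j : I) : ℤ :=
  (if i = j then 1 else 0) - ∑ a, if s a = i ∧ t a = j then 1 else 0

theorem eulerForm_coord {I A : Type} [Fintype I] [Fintype A] [DecidableEq I] (s t : A → I)
    (i j : I) : eulerForm s t (coordVec i) (coordVec j) = eM s t i j := by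
  unfold eulerForm eM coordVec
  congr 1
  · simp [eq_comm]
  · refine Finset.sum_congr rfl fun a _ => ?_
    by_cases h1 : s a = i <;> by_cases h2 : t a = j <;> simp [h1, h2]

theorem eulerN_eq {I A : Type} [Fintype I] [Fintype A] [DecidableEq I] (s t : A → I)
    (v w : I → ℕ) : eulerN s t v w = ∑ i, ∑ j, eM s t i j * ((v i * w j : ℕ) : ℤ) := by
  unfold eulerN eulerForm eM
  simp only [sub_mul, Finset.sum_sub_distrib]
  congr 1
  · simp
  · simp only [Finset.sum_mul]
    have h : ∀ a : A, (v (s a) : ℤ) * w (t a) =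
        ∑ i, ∑ j, (if s a = i ∧ t a = j then 1 else 0) * ((v i * w j : ℕ) : ℤ) := by
      intro a
      rw [Finset.sum_eq_single (s a), Finset.sum_eq_single (t a)]
      · simp
      · intro b _ hb
        simp [hb.symm]
      · simp
      · intro b _ hb
        simp [hb.symm]
      · simp
    rw [Finset.sum_congr rfl fun a _ => h a, Finset.sum_comm]
    refine Finset.sum_congr rfl fun i _ => ?_
    rw [Finset.sum_comm]

theorem C_ne_X (c : Fqx) : (RatFunc.C c : Fqxy) ≠ RatFunc.X := by
  intro h
  rw [← RatFunc.algebraMap_C, ← RatFunc.algebraMap_X] at h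
  exact Polynomial.X_ne_C c (RatFunc.algebraMap_injective _ h).symm

theorem qE_ne : qE ≠ 0 := by
  unfold qE
  simp [RatFunc.X_ne_zero]

theorem xE_ne : xE ≠ 0 := by
  unfold xE
  simp [RatFunc.X_ne_zero]

theorem yE_ne : yE ≠ 0 := RatFunc.X_ne_zero

theorem abs_ne {F K : Type} [Field F] [Field K] (φ : F →+* K) (x q : F) (y : K) (hq : q ≠ 0)
    (hy : ∀ c, φ c ≠ y) (m n : ℤ) : φ x * φ q ^ m - y * φ q ^ n ≠ 0 := by
  intro h
  apply hy (x * q ^ (m - n))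
  have hq' : φ q ≠ 0 := by simpa using hq
  rw [map_mul, map_zpow₀, zpow_sub₀ hq']
  have := zpow_ne_zero n hq'
  field_simp
  linear_combination h

theorem xqq_ne (m n : ℤ) : xE * qE ^ m - yE * qE ^ n ≠ 0 :=
  abs_ne (F := Fqx) (K := Fqxy) RatFunc.C RatFunc.X (RatFunc.C RatFunc.X) RatFunc.X
    (by simp [RatFunc.X_ne_zero]) C_ne_X m n

theorem arrows_le {I A : Type} [Fintype I] [Fintype A] [DecidableEq I] (s t : A → I)
    (hPosDef : ∀ v : I → ℝ, v ≠ 0 → 0 < eulerFormR s t v v + eulerFormR s t v v)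
    (i j : I) (hij : i ≠ j) : (-1 : ℤ) ≤ eM s t i j + eM s t j i := by
  have h := hPosDef (fun k => if k = i ∨ k = j then 1 else 0) (by
    intro h
    have := congrFun h i
    simp at this)
  have h1 : (∑ k, (if k = i ∨ k = j then (1 : ℝ) else 0) * (if k = i ∨ k = j then 1 else 0)) = 2 := by
    have : ∀ k, (if k = i ∨ k = j then (1 : ℝ) else 0) * (if k = i ∨ k = j then 1 else 0)
        = (if k = i then 1 else 0) + (if k = j then 1 else 0) := by
      intro k
      by_cases a : k = i
      · subst a
        simp [hij]
      · simp [a]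
    simp only [this, Finset.sum_add_distrib]
    simp
    norm_num
  have h2 : (((∑ a, if s a = i ∧ t a = j then 1 else 0) +
      (∑ a, if s a = j ∧ t a = i then 1 else 0) : ℤ) : ℝ) ≤
      ∑ a, (if s a = i ∨ s a = j then (1 : ℝ) else 0) * (if t a = i ∨ t a = j then 1 else 0) := by
    push_cast
    rw [← Finset.sum_add_distrib]
    refine Finset.sum_le_sum fun a _ => ?_
    by_cases h1 : s a = i <;> by_cases h2 : t a = j <;> by_cases h3 : s a = j <;>
      by_cases h4 : t a = i <;> simp_all
  unfold eulerFormR at h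
  simp only [h1] at h
  have h3 : (((∑ a, if s a = i ∧ t a = j then 1 else 0) +
      (∑ a, if s a = j ∧ t a = i then 1 else 0) : ℤ) : ℝ) < ((2 : ℤ) : ℝ) := by
    push_cast at h2 ⊢
    linarith
  have h4 := Int.cast_lt.mp h3
  unfold eM
  simp only [hij, hij.symm, if_false]
  linarith

/-- `zetaE` over an abstract field. -/
def zetaA {I A : Type} [Fintype I] [Fintype A] [DecidableEq I] (s t : A → I)
    {K : Type} [Field K] (q : K) (i j : I) (u : K) : K :=
  (u - q ^ (-(coordPair s t i j))) / (u - 1)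

theorem ratio {K : Type} [Field K] (u c : K) (hu : u ≠ 0) (hc : u - 1 ≠ 0) :
    ((u⁻¹ - c) / (u⁻¹ - 1)) / ((u - c) / (u - 1)) = (u * c - 1) / (u - c) := by
  have h2 : u⁻¹ - 1 ≠ 0 := by
    intro h
    apply hc
    field_simp at h
    linear_combination -h
  have h3 : (u⁻¹ - c) / (u⁻¹ - 1) = (u * c - 1) / (u - 1) := by
    rw [div_eq_div_iff h2 hc]
    field_simp
    ring
  rw [h3, div_div_div_cancel_right₀ hc]

/-- The arrow matrix entries vanish unless the potentials differ by one. -/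
theorem arrows_zero {I A : Type} [Fintype I] [Fintype A] [DecidableEq I] (s t : A → I)
    (τ : I → ℤ) (hτ : ∀ a, τ (s a) = τ (t a) + 1) (i j : I) (h : τ i ≠ τ j + 1) :
    eM s t i j = if i = j then 1 else 0 := by
  unfold eM
  rw [Finset.sum_eq_zero, sub_zero]
  intro a _
  rw [if_neg]
  rintro ⟨rfl, rfl⟩
  exact h (hτ a)

theorem arrows_nonpos {I A : Type} [Fintype I] [Fintype A] [DecidableEq I] (s t : A → I)
    (i j : I) (h : i ≠ j) : eM s t i j ≤ 0 := by
  unfold eM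
  rw [if_neg h]
  have : (0 : ℤ) ≤ ∑ a, if s a = i ∧ t a = j then 1 else 0 :=
    Finset.sum_nonneg fun a _ => by split_ifs <;> simp
  linarith

theorem factor {K : Type} [Field K] (x y q : K)
    (hx : x ≠ 0) (hy : y ≠ 0) (hq : q ≠ 0) (hne : ∀ m n : ℤ, x * q ^ m - y * q ^ n ≠ 0)
    {I A : Type} [Fintype I] [Fintype A] [DecidableEq I] (s t : A → I)
    (hPosDef : ∀ v : I → ℝ, v ≠ 0 → 0 < eulerFormR s t v v + eulerFormR s t v v)
    (τ : I → ℤ) (hτ : ∀ a, τ (s a) = τ (t a) + 1) (i j : I) :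
    zetaA s t q j i ((y * q ^ (τ j)) / (x * q ^ (τ i))) /
          zetaA s t q i j ((x * q ^ (τ i)) / (y * q ^ (τ j))) =
      ((x - y) / (x * q - y * q⁻¹)) ^ (eM s t i j) *
        ((x * q⁻¹ - y * q) / (x - y)) ^ (eM s t j i) := by
  have hqi := zpow_ne_zero (τ i) hq
  have hqj := zpow_ne_zero (τ j) hq
  have n1 : x - y ≠ 0 := by simpa using hne 0 0
  have n2 : x * q - y * q⁻¹ ≠ 0 := by simpa using hne 1 (-1)
  have n3 : x * q⁻¹ - y * q ≠ 0 := by simpa using hne (-1) 1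
  have hz : (x * q ^ (τ i)) / (y * q ^ (τ j)) = x / y * q ^ (τ i - τ j) := by
    rw [zpow_sub₀ hq]
    field_simp
  have hinv : (y * q ^ (τ j)) / (x * q ^ (τ i)) =
      ((x * q ^ (τ i)) / (y * q ^ (τ j)))⁻¹ := by rw [inv_div]
  have hu1 : ∀ n : ℤ, x / y * q ^ n - 1 ≠ 0 := by
    intro n h
    apply hne n 0
    field_simp at h
    rw [zpow_zero]
    linear_combination h
  have hcp : coordPair s t j i = coordPair s t i j := add_comm _ _
  have hcp2 : coordPair s t i j = eM s t i j + eM s t j i := by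
    unfold coordPair
    rw [eulerForm_coord, eulerForm_coord]
  unfold zetaA
  rw [hinv, hcp, hz, ratio _ _ (mul_ne_zero (div_ne_zero hx hy) (zpow_ne_zero _ hq)) (hu1 _), hcp2]
  by_cases hij : i = j
  · subst hij
    rw [arrows_zero s t τ hτ i i (by omega)]
    simp only [if_true, sub_self, zpow_zero, zpow_one, mul_one]
    rw [show (-(1 + 1) : ℤ) = -2 by norm_num, zpow_neg]
    have e2 : x / y - (q ^ (2 : ℤ))⁻¹ = (x * q - y * q⁻¹) / (y * q) := by
      field_simp
    have e1 : x / y * (q ^ (2 : ℤ))⁻¹ - 1 = (x * q⁻¹ - y * q) / (y * q) := by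
      field_simp
    rw [e1, e2, div_div_div_cancel_right₀ (mul_ne_zero hy hq)]
    rw [mul_comm (_ / _) (_ / _), div_mul_div_cancel₀ n1]
  have hle := arrows_le s t hPosDef i j hij
  have hn1 := arrows_nonpos s t i j hij
  have hn2 := arrows_nonpos s t j i (Ne.symm hij)
  have hz1 := arrows_zero s t τ hτ i j
  have hz2 := arrows_zero s t τ hτ j i
  rw [if_neg hij] at hz1
  rw [if_neg (Ne.symm hij)] at hz2
  have hcases : (eM s t i j = 0 ∧ eM s t j i = 0) ∨
      (eM s t i j = -1 ∧ eM s t j i = 0 ∧ τ i - τ j = 1) ∨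
      (eM s t i j = 0 ∧ eM s t j i = -1 ∧ τ i - τ j = -1) := by
    by_cases a : τ i = τ j + 1
    · have := hz2 (by omega)
      omega
    · have := hz1 a
      by_cases b : τ j = τ i + 1
      · omega
      · have := hz2 b
        omega
  rcases hcases with ⟨h1, h2⟩ | ⟨h1, h2, h3⟩ | ⟨h1, h2, h3⟩
  · rw [h1, h2]
    simp only [add_zero, neg_zero, zpow_zero, mul_one]
    exact div_self (hu1 _)
  · rw [h1, h2, h3]
    simp only [add_zero, neg_neg, zpow_zero, zpow_one, mul_one, zpow_neg, inv_div]
    have e1 : x / y * q * q - 1 = (x * q - y * q⁻¹) * (q / y) := by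
      field_simp
    have e2 : x / y * q - q = (x - y) * (q / y) := by
      field_simp
    rw [e1, e2, mul_div_mul_right _ _ (div_ne_zero hq hy)]
  · rw [h1, h2, h3]
    simp only [zero_add, neg_neg, zpow_zero, zpow_one, one_mul, zpow_neg, inv_div]
    have e1 : x / y * q⁻¹ * q - 1 = (x - y) / y := by
      field_simp
    have e2 : x / y * q⁻¹ - q = (x * q⁻¹ - y * q) / y := by
      field_simp
    rw [e1, e2, div_div_div_cancel_right₀ hy]

theorem absMain {K : Type} [Field K] (x y q : K)
    (hx : x ≠ 0) (hy : y ≠ 0) (hq : q ≠ 0) (hne : ∀ m n : ℤ, x * q ^ m - y * q ^ n ≠ 0)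
    {I A : Type} [Fintype I] [Fintype A] [DecidableEq I] (s t : A → I)
    (hPosDef : ∀ v : I → ℝ, v ≠ 0 → 0 < eulerFormR s t v v + eulerFormR s t v v)
    (τ : I → ℤ) (hτ : ∀ a, τ (s a) = τ (t a) + 1) (v w : I → ℕ) :
    (∏ i, ∏ j,
        (zetaA s t q j i ((y * q ^ (τ j)) / (x * q ^ (τ i))) /
          zetaA s t q i j ((x * q ^ (τ i)) / (y * q ^ (τ j)))) ^ (v i * w j)) =
      ((x - y) / (x * q - y * q⁻¹)) ^ (eulerN s t v w) *
        ((x * q⁻¹ - y * q) / (x - y)) ^ (eulerN s t w v) := by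
  have n1 : x - y ≠ 0 := by simpa using hne 0 0
  have n2 : x * q - y * q⁻¹ ≠ 0 := by simpa using hne 1 (-1)
  have n3 : x * q⁻¹ - y * q ≠ 0 := by simpa using hne (-1) 1
  have zsum : ∀ (P : K), P ≠ 0 → ∀ (S : Finset I) (f : I → ℤ),
      P ^ (∑ i ∈ S, f i) = ∏ i ∈ S, P ^ f i := by
    intro P hP S f
    induction S using Finset.induction_on with
    | empty => simp
    | insert a S ha ih => rw [Finset.sum_insert ha, Finset.prod_insert ha, zpow_add₀ hP, ih]
  rw [eulerN_eq s t v w, eulerN_eq s t w v, Finset.sum_comm (f := fun i j =>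
    eM s t i j * ((w i * v j : ℕ) : ℤ))]
  rw [zsum _ (div_ne_zero n1 n2), zsum _ (div_ne_zero n3 n1), ← Finset.prod_mul_distrib]
  refine Finset.prod_congr rfl fun i _ => ?_
  rw [zsum _ (div_ne_zero n1 n2), zsum _ (div_ne_zero n3 n1), ← Finset.prod_mul_distrib]
  refine Finset.prod_congr rfl fun j _ => ?_
  rw [factor x y q hx hy hq hne s t hPosDef τ hτ i j, mul_pow, zpow_mul, zpow_mul, zpow_natCast, zpow_natCast,
    mul_comm (w j) (v i)]

theorem absEnd {K : Type} [Field K] (a b c : K) :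
    (a / b) ^ (-1 : ℤ) * c ^ (0 : ℤ) = b / a := by
  rw [zpow_zero, mul_one, zpow_neg_one, inv_div]

/-- the identity
`∏_{i,j} [ζ_{ji}(yq^{τ(j)}/(xq^{τ(i)})) / ζ_{ij}(xq^{τ(i)}/(yq^{τ(j)}))]^{v_i w_j}
 = ((x-y)/(xq-yq^{-1}))^{⟨v,w⟩} ((xq^{-1}-yq)/(x-y))^{⟨w,v⟩}` in `ℚ(q)(x,y)`;
in particular if `⟨v,w⟩ = -1` and `⟨w,v⟩ = 0` it equals `(xq-yq^{-1})/(x-y)`. -/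
theorem stmt11
    (I A : Type) [Fintype I] [Fintype A] [DecidableEq I] (s t : A → I)
    (hNoLoops : ∀ a, s a ≠ t a)
    (hPosDef : ∀ v : I → ℝ, v ≠ 0 → 0 < eulerFormR s t v v + eulerFormR s t v v)
    (τ : I → ℤ) (hτ : ∀ a, τ (s a) = τ (t a) + 1)
    (v w : I → ℕ) :
    (∏ i, ∏ j,
        (zetaE s t j i ((yE * qE ^ (τ j)) / (xE * qE ^ (τ i))) /
          zetaE s t i j ((xE * qE ^ (τ i)) / (yE * qE ^ (τ j)))) ^ (v i * w j)) =
      ((xE - yE) / (xE * qE - yE * qE⁻¹)) ^ (eulerN s t v w) *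
        ((xE * qE⁻¹ - yE * qE) / (xE - yE)) ^ (eulerN s t w v) ∧
    (eulerN s t v w = -1 → eulerN s t w v = 0 →
      (∏ i, ∏ j,
          (zetaE s t j i ((yE * qE ^ (τ j)) / (xE * qE ^ (τ i))) /
            zetaE s t i j ((xE * qE ^ (τ i)) / (yE * qE ^ (τ j)))) ^ (v i * w j)) =
        (xE * qE - yE * qE⁻¹) / (xE - yE)) := by
  have main : (∏ i, ∏ j,
        (zetaE s t j i ((yE * qE ^ (τ j)) / (xE * qE ^ (τ i))) /
          zetaE s t i j ((xE * qE ^ (τ i)) / (yE * qE ^ (τ j)))) ^ (v i * w j)) =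
      ((xE - yE) / (xE * qE - yE * qE⁻¹)) ^ (eulerN s t v w) *
        ((xE * qE⁻¹ - yE * qE) / (xE - yE)) ^ (eulerN s t w v) :=
    absMain (K := Fqxy) xE yE qE xE_ne yE_ne qE_ne xqq_ne s t hPosDef τ hτ v w
  refine ⟨main, fun h1 h2 => ?_⟩
  rw [main, h1, h2]
  exact absEnd (K := Fqxy) _ _ _
end ADEShuffle
end
end
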